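/- arXiv:2401.13263 — 2 statements merged into one kernel-verified Lean document; each statement's English description precedes it below -/
import Mathlib

section
/- Let n ≥ 2 and 1 ≤ p < n, and let Ω ⊂ ℝⁿ be a bounded uniform domain. Then Ω is a local Sobolev–Poincaré imbedding domain of order p: there exist constants C ≥ 1 and λ ≥ 1 such that for every locally Lipschitz function u : Ω → ℝ, every x ∈ Ω and every 0 < r < diam(Ω), inf_{c∈ℝ} (∫_{B(x,r)∩Ω} |u(y) − c|^{np/(n−p)} dy)^{(n−p)/(np)} ≤ C (∫_{B(x,λr)∩Ω} |∇u(y)|^p dy)^{1/p}. -/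
open Set Metric MeasureTheory ENNReal NNReal

noncomputable section

/-- Euclidean space `ℝⁿ`. -/
abbrev Euc (n : ℕ) : Type := EuclideanSpace ℝ (Fin n)

/-- `u` is locally Lipschitz on the set `Ω`. -/
def LocallyLipschitzOnSet {n : ℕ} (u : Euc n → ℝ) (Ω : Set (Euc n)) : Prop :=
  ∀ x ∈ Ω, ∃ K : ℝ≥0, ∃ s ∈ nhdsWithin x Ω, LipschitzOnWith K u s

/-- `x` and `y` are joined by a (continuous) curve lying in `S`. -/
def JoinedByCurveIn {n : ℕ} (S : Set (Euc n)) (x y : Euc n) : Prop :=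
  ∃ γ : ℝ → Euc n, ContinuousOn γ (Icc 0 1) ∧ γ 0 = x ∧ γ 1 = y ∧ MapsTo γ (Icc 0 1) S

/-- `γ` is parametrized by arclength on `[0, L]`. -/
def ArclengthOn {n : ℕ} (γ : ℝ → Euc n) (L : ℝ) : Prop :=
  ∀ s t : ℝ, 0 ≤ s → s ≤ t → t ≤ L → eVariationOn γ (Icc s t) = ENNReal.ofReal (t - s)

/-- `Ω` is an `ε₀`-uniform domain. -/
def IsUniformWith {n : ℕ} (Ω : Set (Euc n)) (ε₀ : ℝ) : Prop :=
  ∀ x ∈ Ω, ∀ y ∈ Ω, ∃ γ : ℝ → Euc n,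
    ContinuousOn γ (Icc 0 1) ∧ γ 0 = x ∧ γ 1 = y ∧ MapsTo γ (Icc 0 1) Ω ∧
    eVariationOn γ (Icc 0 1) ≤ ENNReal.ofReal (dist x y / ε₀) ∧
    ∀ t ∈ Icc (0:ℝ) 1,
      ε₀ * (dist x (γ t) * dist y (γ t)) / dist x y ≤ infDist (γ t) (frontier Ω)

/-- `Ω` is a uniform domain. -/
def IsUniformDomain {n : ℕ} (Ω : Set (Euc n)) : Prop :=
  ∃ ε₀ : ℝ, 0 < ε₀ ∧ ε₀ ≤ 1 ∧ IsUniformWith Ω ε₀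

/-- `Ω` is an `α`-cigar domain: any two points can be joined by a rectifiable
(arclength-parametrized) curve in `Ω` along which
`∫_γ dist(z, ∂Ω)^(α-1) |dz| ≤ C |x - y|^α`. -/
def IsCigarDomain {n : ℕ} (Ω : Set (Euc n)) (α : ℝ) : Prop :=
  ∃ C : ℝ, 0 < C ∧ ∀ x ∈ Ω, ∀ y ∈ Ω, ∃ L : ℝ, 0 ≤ L ∧ ∃ γ : ℝ → Euc n,
    γ 0 = x ∧ γ L = y ∧ MapsTo γ (Icc 0 L) Ω ∧ ArclengthOn γ L ∧
    (∫⁻ t in Icc (0:ℝ) L, ENNReal.ofReal (infDist (γ t) (frontier Ω) ^ (α - 1)) ∂volume)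
      ≤ ENNReal.ofReal (C * dist x y ^ α)

/-- `Ω` is a `c₀`-John domain. -/
def IsJohnDomain {n : ℕ} (Ω : Set (Euc n)) (c₀ : ℝ) : Prop :=
  ∃ x₀ ∈ Ω, ∀ x ∈ Ω, ∃ l : ℝ, 0 ≤ l ∧ ∃ γ : ℝ → Euc n,
    γ 0 = x ∧ γ l = x₀ ∧ MapsTo γ (Icc 0 l) Ω ∧ ArclengthOn γ l ∧
    ∀ t ∈ Icc (0:ℝ) l, c₀ * t ≤ infDist (γ t) (frontier Ω)

/-- `Ω` has the `C`-slice property with respect to `x₀`. -/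
def HasSliceProperty {n : ℕ} (Ω : Set (Euc n)) (C : ℝ) (x₀ : Euc n) : Prop :=
  ∀ x ∈ Ω, ∃ γ : ℝ → Euc n,
    ContinuousOn γ (Icc 0 1) ∧ γ 0 = x₀ ∧ γ 1 = x ∧ MapsTo γ (Icc 0 1) Ω ∧
    ∃ j : ℕ, ∃ U : Fin (j + 1) → Set (Euc n),
      (∀ i, IsOpen (U i) ∧ U i ⊆ Ω) ∧
      (Pairwise fun i₁ i₂ => Disjoint (U i₁) (U i₂)) ∧
      -- (1)
      x₀ ∈ U 0 ∧ x ∈ U (Fin.last j) ∧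
      (∀ i : Fin (j + 1), 0 < (i : ℕ) → (i : ℕ) < j →
        x₀ ∈ Ω \ closure (U i) ∧ x ∈ Ω \ closure (U i) ∧
        x ∉ connectedComponentIn (Ω \ closure (U i)) x₀) ∧
      -- (2)
      (∀ i : Fin (j + 1), 0 < (i : ℕ) → (i : ℕ) < j →
        ∀ γ' : ℝ → Euc n, ContinuousOn γ' (Icc 0 1) → MapsTo γ' (Icc 0 1) Ω →
          (∃ t ∈ Icc (0:ℝ) 1, γ' t = x) → (∃ t ∈ Icc (0:ℝ) 1, γ' t = x₀) →
          ENNReal.ofReal (diam (U i)) ≤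
            ENNReal.ofReal C * eVariationOn γ' {t ∈ Icc (0:ℝ) 1 | γ' t ∈ U i}) ∧
      -- (3)
      (∀ t ∈ Icc (0:ℝ) 1,
        ball (γ t) (infDist (γ t) (frontier Ω) / C) ⊆ ⋃ i, closure (U i)) ∧
      -- (4)
      (∀ i : Fin (j + 1), ∀ t ∈ Icc (0:ℝ) 1, γ t ∈ U i →
        diam (U i) ≤ C * infDist (γ t) (frontier Ω)) ∧
      (∀ i : Fin (j + 1), ∃ xi ∈ U i, (∃ t ∈ Icc (0:ℝ) 1, γ t = xi) ∧
        ((i : ℕ) = j → xi = x) ∧ ball xi (infDist xi (frontier Ω) / C) ⊆ U i)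

/-- `Ω` satisfies the slice condition. -/
def SliceCondition {n : ℕ} (Ω : Set (Euc n)) : Prop :=
  ∃ C : ℝ, 1 < C ∧ ∀ x₀ ∈ Ω, HasSliceProperty Ω C x₀

/-- `Ω` is LLC. -/
def IsLLC {n : ℕ} (Ω : Set (Euc n)) : Prop :=
  ∃ b : ℝ, 0 < b ∧ b ≤ 1 ∧ ∀ z : Euc n, ∀ r : ℝ, 0 < r →
    (∀ x ∈ Ω ∩ ball z r, ∀ y ∈ Ω ∩ ball z r, JoinedByCurveIn (Ω ∩ ball z (r / b)) x y) ∧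
    (∀ x ∈ Ω \ ball z r, ∀ y ∈ Ω \ ball z r, JoinedByCurveIn (Ω \ ball z (b * r)) x y)

/-- `Ω` is quasiconvex. -/
def IsQuasiconvex {n : ℕ} (Ω : Set (Euc n)) : Prop :=
  ∃ C : ℝ, 1 ≤ C ∧ ∀ x ∈ Ω, ∀ y ∈ Ω, ∃ γ : ℝ → Euc n,
    ContinuousOn γ (Icc 0 1) ∧ γ 0 = x ∧ γ 1 = y ∧ MapsTo γ (Icc 0 1) Ω ∧
    eVariationOn γ (Icc 0 1) ≤ ENNReal.ofReal (C * dist x y)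

/-- The intrinsic (inner) metric of `Ω` (`∞` if there is no rectifiable curve). -/
def intrinsicDist {n : ℕ} (Ω : Set (Euc n)) (x y : Euc n) : ℝ≥0∞ :=
  ⨅ (γ : ℝ → Euc n)
    (_ : ContinuousOn γ (Icc 0 1) ∧ γ 0 = x ∧ γ 1 = y ∧ MapsTo γ (Icc 0 1) Ω),
    eVariationOn γ (Icc 0 1)

/-- The intrinsic ball `B_Ω(x, r)`. -/
def intrinsicBall {n : ℕ} (Ω : Set (Euc n)) (x : Euc n) (r : ℝ) : Set (Euc n) :=
  {y ∈ Ω | intrinsicDist Ω x y < ENNReal.ofReal r}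

/-- `Ω` is intrinsic Ahlfors `n`-regular. -/
def IntrinsicAhlforsRegular {n : ℕ} (Ω : Set (Euc n)) : Prop :=
  ∃ c : ℝ, 0 < c ∧ c < 1 ∧ ∃ r₀ : ℝ, 0 < r₀ ∧ ∀ x ∈ Ω, ∀ r : ℝ, 0 < r → r < r₀ →
    ENNReal.ofReal c * volume (ball x r) ≤ volume (intrinsicBall Ω x r)

/-- `Ω` is a local Sobolev–Poincaré imbedding domain of order `p`, `1 ≤ p < n`. -/
def LocalSPLow (n : ℕ) (Ω : Set (Euc n)) (p : ℝ) : Prop :=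
  ∃ C : ℝ, 1 ≤ C ∧ ∃ lam : ℝ, 1 ≤ lam ∧
    ∀ u : Euc n → ℝ, LocallyLipschitzOnSet u Ω →
      ∀ x ∈ Ω, ∀ r : ℝ, 0 < r → r < diam Ω →
        (⨅ c : ℝ, (∫⁻ y in ball x r ∩ Ω,
            ENNReal.ofReal |u y - c| ^ ((n : ℝ) * p / ((n : ℝ) - p)) ∂volume)
              ^ (((n : ℝ) - p) / ((n : ℝ) * p)))
          ≤ ENNReal.ofReal C *
            (∫⁻ y in ball x (lam * r) ∩ Ω,
              ENNReal.ofReal ‖fderiv ℝ u y‖ ^ p ∂volume) ^ (1 / p)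

/-- `Ω` is a local Sobolev–Poincaré imbedding domain of order `n`
(local Trudinger inequality). -/
def LocalSPn (n : ℕ) (Ω : Set (Euc n)) : Prop :=
  ∃ C : ℝ, 1 ≤ C ∧ ∃ lam : ℝ, 1 ≤ lam ∧ ∃ A : ℝ, 0 < A ∧
    ∀ u : Euc n → ℝ, LocallyLipschitzOnSet u Ω →
      ∀ x ∈ Ω, ∀ r : ℝ, 0 < r → r < diam Ω →
        0 < (∫⁻ y in ball x (lam * r) ∩ Ω,
              ENNReal.ofReal ‖fderiv ℝ u y‖ ^ (n : ℝ) ∂volume) →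
        (∫⁻ y in ball x (lam * r) ∩ Ω,
              ENNReal.ofReal ‖fderiv ℝ u y‖ ^ (n : ℝ) ∂volume) < ⊤ →
        (⨅ c : ℝ, ∫⁻ y in ball x r ∩ Ω,
            ENNReal.ofReal (Real.exp ((A * |u y - c| /
              (∫⁻ z in ball x (lam * r) ∩ Ω,
                ENNReal.ofReal ‖fderiv ℝ u z‖ ^ (n : ℝ) ∂volume).toReal
                  ^ ((1 : ℝ) / (n : ℝ))) ^ ((n : ℝ) / ((n : ℝ) - 1)))) ∂volume)
          ≤ ENNReal.ofReal C * volume (ball x r)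

/-- `Ω` is a local Sobolev–Poincaré imbedding domain of order `p`, `n < p < ∞`
(local Morrey inequality). -/
def LocalSPHigh (n : ℕ) (Ω : Set (Euc n)) (p : ℝ) : Prop :=
  ∃ C : ℝ, 1 ≤ C ∧ ∃ lam : ℝ, 1 ≤ lam ∧
    ∀ u : Euc n → ℝ, LocallyLipschitzOnSet u Ω →
      ∀ x ∈ Ω, ∀ r : ℝ, 0 < r → r < diam Ω →
        ∀ x₁ ∈ ball x r ∩ Ω, ∀ x₂ ∈ ball x r ∩ Ω,
          ENNReal.ofReal |u x₁ - u x₂| ≤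
            ENNReal.ofReal (C * dist x₁ x₂ ^ (1 - (n : ℝ) / p)) *
              (∫⁻ y in ball x (lam * r) ∩ Ω,
                ENNReal.ofReal ‖fderiv ℝ u y‖ ^ p ∂volume) ^ (1 / p)

/-- `Ω` is a `p`-Poincaré domain. -/
def PoincareDomain (n : ℕ) (Ω : Set (Euc n)) (p : ℝ) : Prop :=
  ∃ C : ℝ, 1 ≤ C ∧ ∃ lam : ℝ, 1 ≤ lam ∧
    ∀ u : Euc n → ℝ, LocallyLipschitzOnSet u Ω →
      ∀ x ∈ Ω, ∀ r : ℝ, 0 < r → r < diam Ω →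
        (volume (ball x r ∩ Ω))⁻¹ *
          (∫⁻ y in ball x r ∩ Ω,
            ENNReal.ofReal |u y - ⨍ z in ball x r ∩ Ω, u z ∂volume| ∂volume)
          ≤ ENNReal.ofReal (C * r) *
            ((volume (ball x (lam * r) ∩ Ω))⁻¹ *
              ∫⁻ y in ball x (lam * r) ∩ Ω,
                ENNReal.ofReal ‖fderiv ℝ u y‖ ^ p ∂volume) ^ (1 / p)

theorem LocallyLipschitzOn.ae_differentiableAt {n : ℕ} {u : Euc n → ℝ} {Ω : Set (Euc n)}
    (hΩ : IsOpen Ω) (hu : LocallyLipschitzOn Ω u) :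
    ∀ᵐ z, z ∈ Ω → DifferentiableAt ℝ u z := by
  have key : volume {z | z ∈ Ω ∧ ¬ DifferentiableAt ℝ u z} = 0 := by
    refine measure_null_of_locally_null _ fun x hx => ?_
    obtain ⟨K, t, ht, hK⟩ := hu hx.1
    have ht' : interior t ∈ nhds x := by
      rw [hΩ.nhdsWithin_eq hx.1] at ht
      exact interior_mem_nhds.2 ht
    refine ⟨interior t ∩ {z | z ∈ Ω ∧ ¬ DifferentiableAt ℝ u z},
      Filter.inter_mem (mem_nhdsWithin_of_mem_nhds ht') self_mem_nhdsWithin, ?_⟩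
    have h := (hK.mono interior_subset).ae_differentiableWithinAt_of_mem (μ := volume)
    refine measure_mono_null ?_ (ae_iff.1 h)
    rintro z ⟨hz, -, hz'⟩ h'
    exact hz' ((h' hz).differentiableAt (isOpen_interior.mem_nhds hz))
  rw [ae_iff]
  simpa using key

theorem LipschitzOnWith.edist_le_lintegral_enorm_deriv {h : ℝ → ℝ} {K : ℝ≥0}
    (hh : LipschitzOnWith K h (Icc 0 1)) :
    edist (h 0) (h 1) ≤ ∫⁻ t in Icc (0 : ℝ) 1, ‖deriv h t‖ₑ := by
  have hac : AbsolutelyContinuousOnInterval h 0 1 :=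
    LipschitzOnWith.absolutelyContinuousOnInterval (by rwa [uIcc_of_le zero_le_one])
  rw [edist_comm, edist_eq_enorm_sub, ← hac.integral_deriv_eq_sub,
    intervalIntegral.integral_of_le zero_le_one]
  exact (enorm_integral_le_lintegral_enorm _).trans (lintegral_mono_set Ioc_subset_Icc_self)

theorem setLIntegral_ball_comp_add_smul {n : ℕ} {f : Euc n → ℝ≥0∞} (hf : Measurable f)
    (a : Euc n) {ρ : ℝ} (hρ : 0 < ρ) :
    ∫⁻ w in ball (0 : Euc n) 1, f (a + ρ • w)
      = ENNReal.ofReal (ρ ^ n)⁻¹ * ∫⁻ z in ball a ρ, f z := by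
  have hmap : Measure.map (fun w : Euc n => a + ρ • w) volume
      = ENNReal.ofReal (ρ ^ n)⁻¹ • volume := by
    have h1 := Measure.map_addHaar_smul (volume : Measure (Euc n)) hρ.ne'
    rw [finrank_euclideanSpace_fin, abs_of_pos (by positivity)] at h1
    have h2 : (fun w : Euc n => a + ρ • w) = (fun z => a + z) ∘ (fun w => ρ • w) := rfl
    rw [h2, ← Measure.map_map (by fun_prop) (by fun_prop), h1, Measure.map_smul,
      map_add_left_eq_self]
  rw [← lintegral_indicator measurableSet_ball, ← lintegral_indicator measurableSet_ball,
    ← smul_eq_mul, ← lintegral_smul_measure, ← hmap,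
    lintegral_map (hf.indicator measurableSet_ball) (by fun_prop)]
  refine lintegral_congr fun w => ?_
  have : w ∈ ball (0 : Euc n) 1 ↔ a + ρ • w ∈ ball a ρ := by
    simp [mem_ball, dist_eq_norm, norm_smul, abs_of_pos hρ, mul_lt_iff_lt_one_right hρ]
  by_cases hw : w ∈ ball (0 : Euc n) 1
  · rw [indicator_of_mem hw, indicator_of_mem (this.1 hw)]
  · rw [indicator_of_notMem hw, indicator_of_notMem (fun h => hw (this.2 h))]

/-- The average of `u` over the ball of centre `a` and radius `ρ`, written over the unit ball. -/
def ballAvg {n : ℕ} (u : Euc n → ℝ) (a : Euc n) (ρ : ℝ) : ℝ :=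
  ⨍ w in ball (0 : Euc n) 1, u (a + ρ • w)

theorem add_smul_mem_closedBall {n : ℕ} {a w : Euc n} {ρ : ℝ} (hρ : 0 ≤ ρ)
    (hw : w ∈ closedBall (0 : Euc n) 1) : a + ρ • w ∈ closedBall a ρ := by
  simp only [mem_closedBall, dist_eq_norm, sub_zero, add_sub_cancel_left, norm_smul,
    Real.norm_eq_abs, abs_of_nonneg hρ] at hw ⊢
  nlinarith

theorem integrableOn_comp_add_smul {n : ℕ} {u : Euc n → ℝ} {a : Euc n} {ρ : ℝ} (hρ : 0 ≤ ρ)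
    (hu : ContinuousOn u (closedBall a ρ)) :
    IntegrableOn (fun w => u (a + ρ • w)) (ball (0 : Euc n) 1) := by
  have : ContinuousOn (fun w => u (a + ρ • w)) (closedBall (0 : Euc n) 1) :=
    hu.comp (by fun_prop) fun w hw => add_smul_mem_closedBall hρ hw
  exact (this.integrableOn_compact (isCompact_closedBall _ _)).mono_set ball_subset_closedBall

theorem edist_setAverage_le {n : ℕ} {f g : Euc n → ℝ} {s : Set (Euc n)}
    (hf : IntegrableOn f s) (hg : IntegrableOn g s) :
    edist (⨍ w in s, f w) (⨍ w in s, g w) ≤ (volume s)⁻¹ * ∫⁻ w in s, edist (f w) (g w) := by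
  rcases eq_or_ne (volume s) 0 with h0 | h0
  · have h1 : volume.restrict s = 0 := Measure.restrict_eq_zero.2 h0
    simp [h1]
  have hs : (volume s)⁻¹ ≠ ∞ := ENNReal.inv_ne_top.2 h0
  rw [average, average, edist_eq_enorm_sub, ← integral_sub]
  · refine (enorm_integral_le_lintegral_enorm _).trans ?_
    rw [lintegral_smul_measure]
    simp [edist_eq_enorm_sub]
  · exact hf.smul_measure (by simpa using hs)
  · exact hg.smul_measure (by simpa using hs)

theorem enorm_deriv_comp_affine_le {n : ℕ} {u : Euc n → ℝ} {v d : Euc n} {t : ℝ}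
    (hu : DifferentiableAt ℝ u (v + t • d)) :
    ‖deriv (fun s : ℝ => u (v + s • d)) t‖ₑ ≤ ‖d‖ₑ * ‖fderiv ℝ u (v + t • d)‖ₑ := by
  have h1 : HasDerivAt (fun s : ℝ => v + s • d) d t := by
    simpa using ((hasDerivAt_id t).smul_const d).const_add v
  have h2 := hu.hasFDerivAt.comp_hasDerivAt t h1
  have h3 : deriv (fun s : ℝ => u (v + s • d)) t = fderiv ℝ u (v + t • d) d := h2.deriv
  rw [h3, mul_comm]
  exact ContinuousLinearMap.le_opENorm _ _

theorem LocallyLipschitzOn.ae_differentiableAt_add_smul {n : ℕ} {u : Euc n → ℝ}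
    {A : Set (Euc n)} (hA : IsOpen A) (hu : LocallyLipschitzOn A u) {a : Euc n} {ρ : ℝ}
    (hρ : 0 < ρ) (hsub : closedBall a ρ ⊆ A) :
    ∀ᵐ w ∂(volume.restrict (ball (0 : Euc n) 1)), DifferentiableAt ℝ u (a + ρ • w) := by
  have hS : MeasurableSet (A ∩ {z | DifferentiableAt ℝ u z}ᶜ) :=
    hA.measurableSet.inter (measurableSet_of_differentiableAt ℝ u).compl
  have hind : Measurable (indicator (A ∩ {z | DifferentiableAt ℝ u z}ᶜ) (1 : Euc n → ℝ≥0∞)) :=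
    measurable_one.indicator hS
  have hN : ∫⁻ w in ball (0 : Euc n) 1,
      indicator (A ∩ {z | DifferentiableAt ℝ u z}ᶜ) 1 (a + ρ • w) = 0 := by
    rw [setLIntegral_ball_comp_add_smul hind _ hρ]
    refine mul_eq_zero_of_right _ (le_antisymm ?_ zero_le)
    refine (setLIntegral_le_lintegral _ _).trans ?_
    rw [lintegral_indicator_one hS]
    have := hu.ae_differentiableAt hA
    rw [ae_iff] at this
    simp only [Classical.not_imp] at this
    exact this.le
  have hN' := (lintegral_eq_zero_iff (hind.comp (g := indicator _ 1)
    (f := fun w : Euc n => a + ρ • w) (by fun_prop))).1 hN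
  filter_upwards [hN', ae_restrict_mem measurableSet_ball] with w hw hwb
  by_contra hcon
  have : a + ρ • w ∈ A ∩ {z | DifferentiableAt ℝ u z}ᶜ :=
    ⟨hsub (add_smul_mem_closedBall hρ.le (ball_subset_closedBall hwb)), hcon⟩
  simp only [Function.comp_apply, indicator_of_mem this] at hw
  simp at hw

theorem edist_ballAvg_le {n : ℕ} {u : Euc n → ℝ} {A : Set (Euc n)} (hA : IsOpen A)
    (hu : LocallyLipschitzOn A u) {a b : Euc n} {ρ σ τ : ℝ} (hτ : 0 < τ) (hτρ : τ ≤ ρ)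
    (hτσ : τ ≤ σ)
    (hsub : ∀ t ∈ Icc (0 : ℝ) 1, closedBall (a + t • (b - a)) (ρ + t * (σ - ρ)) ⊆ A) :
    edist (ballAvg u a ρ) (ballAvg u b σ) ≤
      (volume (ball (0 : Euc n) 1))⁻¹ * (ENNReal.ofReal (dist a b + |ρ - σ|) *
        (ENNReal.ofReal (τ ^ n)⁻¹ * ∫⁻ z in A, ‖fderiv ℝ u z‖ₑ)) := by
  have h0 : closedBall a ρ ⊆ A := by simpa using hsub 0 (by simp)
  have h1 : closedBall b σ ⊆ A := by simpa using hsub 1 (by simp)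
  have hρ : 0 < ρ := hτ.trans_le hτρ
  have hσ : 0 < σ := hτ.trans_le hτσ
  have hrad : ∀ t ∈ Icc (0 : ℝ) 1, τ ≤ ρ + t * (σ - ρ) := by
    rintro t ⟨ht0, ht1⟩
    nlinarith
  let φ : ℝ → Euc n → Euc n := fun t w => (a + t • (b - a)) + (ρ + t * (σ - ρ)) • w
  have hφm : Measurable (fun q : Euc n × ℝ => φ q.2 q.1) := by
    apply Continuous.measurable
    fun_prop
  have hφ : ∀ t w, φ t w = (a + ρ • w) + t • ((b - a) + (σ - ρ) • w) := by
    intro t w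
    simp only [φ]
    module
  have hφA : ∀ t ∈ Icc (0 : ℝ) 1, ∀ w ∈ closedBall (0 : Euc n) 1, φ t w ∈ A := fun t ht w hw =>
    hsub t ht (add_smul_mem_closedBall (hτ.le.trans (hrad t ht)) hw)
  have hg : Measurable fun z => ‖fderiv ℝ u z‖ₑ := (measurable_fderiv ℝ u).enorm
  refine (edist_setAverage_le (integrableOn_comp_add_smul hρ.le (hu.continuousOn.mono h0))
    (integrableOn_comp_add_smul hσ.le (hu.continuousOn.mono h1))).trans ?_
  gcongr
  set L := ENNReal.ofReal (dist a b + |ρ - σ|)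
  have hL : ∀ w ∈ ball (0 : Euc n) 1, ‖(b - a) + (σ - ρ) • w‖ₑ ≤ L := by
    intro w hw
    rw [← ofReal_norm]
    refine ENNReal.ofReal_le_ofReal ((norm_add_le _ _).trans ?_)
    rw [norm_smul, dist_comm, dist_eq_norm, Real.norm_eq_abs, abs_sub_comm]
    have : ‖w‖ ≤ 1 := by simpa using ball_subset_closedBall hw
    nlinarith [abs_nonneg (ρ - σ)]
  -- differentiability along almost every segment
  have hdiff : ∀ᵐ w ∂(volume.restrict (ball (0 : Euc n) 1)),
      ∀ᵐ t ∂(volume.restrict (Icc (0 : ℝ) 1)), DifferentiableAt ℝ u (φ t w) := by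
    rw [Measure.ae_ae_comm (p := fun w t => DifferentiableAt ℝ u (φ t w))
      (hφm (measurableSet_of_differentiableAt ℝ u))]
    filter_upwards [ae_restrict_mem measurableSet_Icc] with t ht
    exact hu.ae_differentiableAt_add_smul hA (hτ.trans_le (hrad t ht)) (hsub t ht)
  calc ∫⁻ w in ball (0 : Euc n) 1, edist (u (a + ρ • w)) (u (b + σ • w))
      ≤ ∫⁻ w in ball (0 : Euc n) 1, ∫⁻ t in Icc (0 : ℝ) 1, L * ‖fderiv ℝ u (φ t w)‖ₑ := by
        refine lintegral_mono_ae ?_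
        filter_upwards [hdiff, ae_restrict_mem measurableSet_ball] with w hw hwb
        have hcomp : IsCompact ((fun t => φ t w) '' Icc (0 : ℝ) 1) :=
          isCompact_Icc.image (by fun_prop)
        obtain ⟨K, hK⟩ := LocallyLipschitzOn.exists_lipschitzOnWith_of_compact hcomp
          (hu.mono (image_subset_iff.2 fun t ht => hφA t ht w (ball_subset_closedBall hwb)))
        have hlip : LipschitzWith ‖(b - a) + (σ - ρ) • w‖₊ (fun t => φ t w) := by
          refine LipschitzWith.of_dist_le_mul fun s t => ?_
          rw [hφ, hφ, dist_add_left, dist_eq_norm, ← sub_smul, norm_smul, coe_nnnorm, mul_comm,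
            dist_eq_norm]
        have hh : LipschitzOnWith _ (fun t => u (φ t w)) (Icc 0 1) :=
          hK.comp hlip.lipschitzOnWith (mapsTo_image _ _)
        have h01 := hh.edist_le_lintegral_enorm_deriv
        have e0 : φ 0 w = a + ρ • w := by simp [φ]
        have e1 : φ 1 w = b + σ • w := by simp [φ]
        simp only [e0, e1] at h01
        refine h01.trans (lintegral_mono_ae ?_)
        filter_upwards [hw] with t ht
        simp only [hφ] at ht ⊢
        exact (enorm_deriv_comp_affine_le ht).trans (mul_le_mul_left (hL w hwb) _)
    _ = ∫⁻ t in Icc (0 : ℝ) 1, ∫⁻ w in ball (0 : Euc n) 1, L * ‖fderiv ℝ u (φ t w)‖ₑ := by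
        refine lintegral_lintegral_swap ?_
        exact ((hg.comp hφm).const_mul L).aemeasurable
    _ ≤ ∫⁻ _ in Icc (0 : ℝ) 1,
          L * (ENNReal.ofReal (τ ^ n)⁻¹ * ∫⁻ z in A, ‖fderiv ℝ u z‖ₑ) := by
        refine setLIntegral_mono' measurableSet_Icc fun t ht => ?_
        have hpos := hτ.trans_le (hrad t ht)
        have hm : Measurable fun w => ‖fderiv ℝ u (φ t w)‖ₑ :=
          hg.comp (hφm.comp (measurable_id.prodMk measurable_const))
        rw [lintegral_const_mul _ hm]
        gcongr
        rw [setLIntegral_ball_comp_add_smul hg _ hpos]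
        gcongr
        · exact hrad t ht
        · exact ball_subset_closedBall.trans (hsub t ht)
    _ = _ := by simp

theorem edist_ballAvg_le_eVariationOn {n : ℕ} {u : Euc n → ℝ} {A : Set (Euc n)} (hA : IsOpen A)
    (hu : LocallyLipschitzOn A u) {γ : ℝ → Euc n} (hγ : ContinuousOn γ (Icc 0 1)) {ρ : ℝ}
    (hρ : 0 < ρ) (hsub : ∀ t ∈ Icc (0 : ℝ) 1, closedBall (γ t) (2 * ρ) ⊆ A) :
    edist (ballAvg u (γ 0) ρ) (ballAvg u (γ 1) ρ) ≤
      (volume (ball (0 : Euc n) 1))⁻¹ * (eVariationOn γ (Icc 0 1) *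
        (ENNReal.ofReal (ρ ^ n)⁻¹ * ∫⁻ z in A, ‖fderiv ℝ u z‖ₑ)) := by
  have huc := isCompact_Icc.uniformContinuousOn_of_continuous hγ
  obtain ⟨δ, hδ, hδ'⟩ := Metric.uniformContinuousOn_iff.1 huc ρ hρ
  obtain ⟨m, hm⟩ := exists_nat_one_div_lt hδ
  have hm0 : (0 : ℝ) < m + 1 := by positivity
  let p : ℕ → ℝ := fun i => min (i / (m + 1)) 1
  have hp : ∀ i, p i ∈ Icc (0 : ℝ) 1 := fun i => ⟨le_min (by positivity) zero_le_one,
    min_le_right _ _⟩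
  have hmono : Monotone p := fun i j hij => by
    have : (i : ℝ) ≤ j := by exact_mod_cast hij
    simp only [p]
    gcongr
  have hstep : ∀ i, dist (γ (p i)) (γ (p (i + 1))) ≤ ρ := fun i => by
    refine (hδ' _ (hp i) _ (hp (i + 1)) (lt_of_le_of_lt ?_ hm)).le
    refine (abs_min_sub_min_le_max _ _ _ _).trans ?_
    have : (i : ℝ) / (m + 1) - (i + 1 : ℕ) / (m + 1) = -(1 / (m + 1)) := by
      push_cast
      ring
    rw [this, abs_neg, abs_of_pos (by positivity), sub_self, abs_zero]
    exact max_le le_rfl (by positivity)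
  set I := ENNReal.ofReal (ρ ^ n)⁻¹ * ∫⁻ z in A, ‖fderiv ℝ u z‖ₑ
  have hone : ∀ i, edist (ballAvg u (γ (p i)) ρ) (ballAvg u (γ (p (i + 1))) ρ) ≤
      (volume (ball (0 : Euc n) 1))⁻¹ * (edist (γ (p i)) (γ (p (i + 1))) * I) := fun i => by
    have := edist_ballAvg_le hA hu (a := γ (p i)) (b := γ (p (i + 1))) hρ le_rfl le_rfl ?_
    · simpa [edist_dist] using this
    · rintro t ⟨ht0, ht1⟩
      refine Subset.trans (closedBall_subset_closedBall' ?_) (hsub _ (hp i))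
      have := hstep i
      rw [sub_self, mul_zero, add_zero, dist_eq_norm, add_sub_cancel_left, norm_smul,
        Real.norm_eq_abs, abs_of_nonneg ht0, ← dist_eq_norm, dist_comm]
      nlinarith
  have h0 : p 0 = 0 := by simp [p]
  have h1 : p (m + 1) = 1 := by simp [p, div_self hm0.ne']
  calc edist (ballAvg u (γ 0) ρ) (ballAvg u (γ 1) ρ)
      = edist (ballAvg u (γ (p 0)) ρ) (ballAvg u (γ (p (m + 1))) ρ) := by rw [h0, h1]
    _ ≤ ∑ i ∈ Finset.range (m + 1), edist (ballAvg u (γ (p i)) ρ) (ballAvg u (γ (p (i + 1))) ρ) :=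
        edist_le_range_sum_edist (fun i => ballAvg u (γ (p i)) ρ) (m + 1)
    _ ≤ ∑ i ∈ Finset.range (m + 1),
          (volume (ball (0 : Euc n) 1))⁻¹ * (edist (γ (p i)) (γ (p (i + 1))) * I) :=
        Finset.sum_le_sum fun i _ => hone i
    _ = (volume (ball (0 : Euc n) 1))⁻¹ *
          ((∑ i ∈ Finset.range (m + 1), edist (γ (p (i + 1))) (γ (p i))) * I) := by
        simp_rw [← Finset.mul_sum, ← Finset.sum_mul, edist_comm]
    _ ≤ _ := by
        gcongr
        exact eVariationOn.sum_le hmono hp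

theorem ball_subset_of_le_infDist_frontier {n : ℕ} {Ω : Set (Euc n)} {z : Euc n} {δ : ℝ}
    (hz : z ∈ Ω) (hδ : δ ≤ infDist z (frontier Ω)) : ball z δ ⊆ Ω := by
  rcases le_or_gt δ 0 with h0 | h0
  · simp [ball_eq_empty.2 h0]
  by_contra hcon
  obtain ⟨y, hy, hyΩ⟩ := not_subset.1 hcon
  have hcover : ball z δ ⊆ interior Ω ∪ (closure Ω)ᶜ := fun w hw => by
    by_contra hw'
    have hwf : w ∈ frontier Ω :=
      ⟨not_not.1 fun h => hw' (Or.inr h), fun h => hw' (Or.inl h)⟩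
    have := infDist_le_dist_of_mem (x := z) hwf
    rw [mem_ball, dist_comm] at hw
    linarith
  have hz' := mem_ball_self (x := z) h0
  obtain ⟨w, -, hw1, hw2⟩ := (convex_ball z δ).isPreconnected _ _ isOpen_interior
    isClosed_closure.isOpen_compl hcover
    ⟨z, hz', (hcover hz').resolve_right fun h => h (subset_closure hz)⟩
    ⟨y, hy, (hcover hy).resolve_left fun h => hyΩ (interior_subset h)⟩
  exact hw2 (subset_closure (interior_subset hw1))

theorem exists_half_le_dist {n : ℕ} {Ω : Set (Euc n)} {r : ℝ} (hr : 0 < r) (hrd : r < diam Ω)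
    (y : Euc n) : ∃ y' ∈ Ω, r / 2 ≤ dist y y' := by
  by_contra! hcon
  have : Ω ⊆ closedBall y (r / 2) := fun z hz => by
    rw [mem_closedBall, dist_comm]
    exact (hcon z hz).le
  have := diam_le_of_subset_closedBall (by positivity) this
  linarith

theorem IsUniformWith.exists_dist_eq {n : ℕ} {Ω : Set (Euc n)} {ε : ℝ} (hε : 0 < ε)
    (hΩ : IsUniformWith Ω ε) {y y' : Euc n} (hy : y ∈ Ω) (hy' : y' ∈ Ω) {s : ℝ} (hs : 0 < s)
    (hsy : 2 * s ≤ dist y y') :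
    ∃ z ∈ Ω, dist y z = s ∧ ε * s / 2 ≤ infDist z (frontier Ω) := by
  obtain ⟨γ, hγ, h0, h1, hm, -, hd⟩ := hΩ y hy y' hy'
  have hcont : ContinuousOn (fun t => dist y (γ t)) (Icc 0 1) := by fun_prop
  have : s ∈ Icc (dist y (γ 0)) (dist y (γ 1)) := by
    rw [h0, h1, dist_self]
    constructor <;> linarith
  obtain ⟨t, ht, hts⟩ := intermediate_value_Icc zero_le_one hcont this
  simp only at hts
  refine ⟨γ t, hm ht, hts, le_trans ?_ (hd t ht)⟩
  have htri := dist_triangle_right y y' (γ t)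
  rw [hts] at htri ⊢
  rw [le_div_iff₀ (by linarith)]
  have : dist y y' / 2 ≤ dist y' (γ t) := by linarith
  have := mul_le_mul_of_nonneg_left this (mul_pos hε hs).le
  linarith

theorem IsUniformWith.exists_curve {n : ℕ} {Ω : Set (Euc n)} {ε : ℝ} (hε : 0 < ε) (hε1 : ε ≤ 1)
    (hΩ : IsUniformWith Ω ε) {a b : Euc n} (ha : a ∈ Ω) (hb : b ∈ Ω) {δ : ℝ} (hδ : 0 < δ)
    (had : δ ≤ infDist a (frontier Ω)) (hbd : δ ≤ infDist b (frontier Ω)) :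
    ∃ γ : ℝ → Euc n, ContinuousOn γ (Icc 0 1) ∧ γ 0 = a ∧ γ 1 = b ∧
      eVariationOn γ (Icc 0 1) ≤ ENNReal.ofReal (dist a b / ε) ∧
      ∀ t ∈ Icc (0 : ℝ) 1, γ t ∈ Ω ∧ dist a (γ t) ≤ dist a b / ε ∧
        ε * δ / 4 ≤ infDist (γ t) (frontier Ω) := by
  obtain ⟨γ, hγ, h0, h1, hm, hv, hd⟩ := hΩ a ha b hb
  refine ⟨γ, hγ, h0, h1, hv, fun t ht => ⟨hm ht, ?_, ?_⟩⟩
  · have := (eVariationOn.edist_le γ (left_mem_Icc.2 zero_le_one) ht).trans hv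
    rw [h0, edist_dist] at this
    exact (ENNReal.ofReal_le_ofReal_iff (by positivity)).1 this
  have hεδ : ε * δ ≤ δ := by nlinarith
  have hfar : ∀ c, δ ≤ infDist c (frontier Ω) → dist c (γ t) < δ / 2 →
      ε * δ / 4 ≤ infDist (γ t) (frontier Ω) := fun c hc hct => by
    have := infDist_le_infDist_add_dist (s := frontier Ω) (x := c) (y := γ t)
    linarith
  rcases lt_or_ge (dist a (γ t)) (δ / 2) with h | ha2
  · exact hfar a had h
  rcases lt_or_ge (dist b (γ t)) (δ / 2) with h | hb2
  · exact hfar b hbd h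
  have htri := dist_triangle_right a b (γ t)
  refine le_trans ?_ (hd t ht)
  rcases (dist_nonneg (x := a) (y := b)).eq_or_lt with hab | hab
  · have hconst := (eVariationOn.edist_le γ (left_mem_Icc.2 zero_le_one) ht).trans hv
    rw [h0, ← hab] at hconst
    simp only [zero_div, ENNReal.ofReal_zero, nonpos_iff_eq_zero, edist_eq_zero] at hconst
    rw [← hconst, dist_self] at ha2
    linarith
  rw [le_div_iff₀ hab]
  have : δ * dist a b / 4 ≤ dist a (γ t) * dist b (γ t) := by
    nlinarith [mul_nonneg (sub_nonneg.2 ha2) (sub_nonneg.2 hb2)]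
  nlinarith

theorem IsUniformWith.edist_ballAvg_le {n : ℕ} {Ω : Set (Euc n)} {ε : ℝ} (hε : 0 < ε)
    (hε1 : ε ≤ 1) (hOpen : IsOpen Ω) (hΩ : IsUniformWith Ω ε) {u : Euc n → ℝ}
    (hu : LocallyLipschitzOn Ω u) {a b : Euc n} (ha : a ∈ Ω) (hb : b ∈ Ω) {δ : ℝ} (hδ : 0 < δ)
    (had : δ ≤ infDist a (frontier Ω)) (hbd : δ ≤ infDist b (frontier Ω)) {c : Euc n} {R : ℝ}
    (hR : dist a c + dist a b / ε + δ ≤ R) :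
    edist (ballAvg u a (ε * δ / 16)) (ballAvg u b (ε * δ / 16)) ≤
      (volume (ball (0 : Euc n) 1))⁻¹ * (ENNReal.ofReal (dist a b / ε) *
        (ENNReal.ofReal ((ε * δ / 16) ^ n)⁻¹ * ∫⁻ z in Ω ∩ ball c R, ‖fderiv ℝ u z‖ₑ)) := by
  obtain ⟨γ, hγ, h0, h1, hv, hγ'⟩ := hΩ.exists_curve hε hε1 ha hb hδ had hbd
  have hεδ : 0 < ε * δ := mul_pos hε hδ
  have h := edist_ballAvg_le_eVariationOn (hOpen.inter isOpen_ball)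
    (hu.mono (inter_subset_left (t := ball c R))) hγ (ρ := ε * δ / 16) (by positivity) ?_
  · rw [h0, h1] at h
    refine h.trans ?_
    gcongr
  · intro t ht
    obtain ⟨hΩt, hdt, hit⟩ := hγ' t ht
    refine subset_inter ((closedBall_subset_ball ?_).trans
      (ball_subset_of_le_infDist_frontier hΩt hit)) (closedBall_subset_ball' ?_)
    · linarith
    · have := dist_triangle_left (γ t) c a
      nlinarith

theorem tendsto_ballAvg {n : ℕ} {u : Euc n → ℝ} {Ω : Set (Euc n)} (hOpen : IsOpen Ω)
    (hu : ContinuousOn u Ω) {y : Euc n} (hy : y ∈ Ω) {z : ℕ → Euc n} {ρ : ℕ → ℝ}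
    (hρ : ∀ k, 0 ≤ ρ k) (hsub : ∀ k, closedBall (z k) (ρ k) ⊆ Ω)
    (hlim : Filter.Tendsto (fun k => dist (z k) y + ρ k) Filter.atTop (nhds 0)) :
    Filter.Tendsto (fun k => ballAvg u (z k) (ρ k)) Filter.atTop (nhds (u y)) := by
  rw [Metric.tendsto_nhds]
  intro η hη
  obtain ⟨δ, hδ, hδ'⟩ := Metric.continuousAt_iff.1 (hu.continuousAt (hOpen.mem_nhds hy)) (η / 2)
    (by positivity)
  filter_upwards [hlim.eventually_lt_const hδ] with k hk
  have hmem : ballAvg u (z k) (ρ k) ∈ closedBall (u y) (η / 2) := by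
    refine (convex_closedBall _ _).set_average_mem isClosed_closedBall
      (measure_ball_pos _ _ one_pos).ne' measure_ball_lt_top.ne ?_
      (integrableOn_comp_add_smul (hρ k) (hu.mono (hsub k)))
    filter_upwards [ae_restrict_mem measurableSet_ball] with w hw
    have h1 := add_smul_mem_closedBall (a := z k) (hρ k) (ball_subset_closedBall hw)
    rw [mem_closedBall] at h1
    have h2 := dist_triangle (z k + ρ k • w) (z k) y
    exact (hδ' (by linarith)).le
  rw [mem_closedBall] at hmem
  linarith

theorem IsUniformWith.edist_ballAvg_ballAvg_le {n : ℕ} {Ω : Set (Euc n)} {ε : ℝ} (hε : 0 < ε)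
    (hε1 : ε ≤ 1) (hOpen : IsOpen Ω) (hΩ : IsUniformWith Ω ε) {u : Euc n → ℝ}
    (hu : LocallyLipschitzOn Ω u) {z z' y : Euc n} {s ρ : ℝ} (hs : 0 < s) (hz : z ∈ Ω)
    (hz' : z' ∈ Ω) (hzd : ε * s / 4 ≤ infDist z (frontier Ω))
    (hzd' : ε * s / 4 ≤ infDist z' (frontier Ω)) (hzy : dist z y ≤ s) (hzz : dist z z' ≤ 6 * s)
    (hρ1 : ε ^ 2 * s / 128 ≤ ρ) (hρ2 : ρ ≤ ε ^ 2 * s / 64) :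
    edist (ballAvg u z (ε ^ 2 * s / 64)) (ballAvg u z' ρ) ≤
      (volume (ball (0 : Euc n) 1))⁻¹ * (ENNReal.ofReal (7 / ε * ((ε ^ 2 / 128) ^ n)⁻¹) *
        (ENNReal.ofReal (s * (s ^ n)⁻¹) *
          ∫⁻ w in Ω ∩ ball y (8 / ε * s), ‖fderiv ℝ u w‖ₑ)) := by
  set I := ∫⁻ w in Ω ∩ ball y (8 / ε * s), ‖fderiv ℝ u w‖ₑ
  have hε2 : ε ^ 2 ≤ ε := by nlinarith
  have hεs : ε * s ≤ s := by nlinarith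
  have hε2s : ε ^ 2 * s ≤ ε * s := by nlinarith
  have hsε : s ≤ s / ε := by rw [le_div_iff₀ hε]; linarith
  have hball : 8 / ε * s = 8 * (s / ε) := by ring
  have hpos : 0 < ε ^ 2 * s / 128 := by positivity
  have e : ε * (ε * s / 4) / 16 = ε ^ 2 * s / 64 := by ring
  have hmove := hΩ.edist_ballAvg_le hε hε1 hOpen hu hz hz' (δ := ε * s / 4) (by positivity)
    hzd hzd' (c := y) (R := 8 / ε * s) (by
      have : dist z z' / ε ≤ 6 * s / ε := by gcongr
      have e6 : 6 * s / ε = 6 * (s / ε) := by ring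
      rw [hball]
      linarith)
  rw [e] at hmove
  have hrad := _root_.edist_ballAvg_le (hOpen.inter isOpen_ball)
    (hu.mono (inter_subset_left (t := ball y (8 / ε * s)))) (a := z') (b := z')
    (ρ := ε ^ 2 * s / 64) (σ := ρ) hpos (by linarith) hρ1 (by
      rintro t ⟨ht0, ht1⟩
      have hle : ε ^ 2 * s / 64 + t * (ρ - ε ^ 2 * s / 64) ≤ ε ^ 2 * s / 64 := by nlinarith
      rw [sub_self, smul_zero, add_zero]
      refine (closedBall_subset_closedBall hle).trans (subset_inter ?_ ?_)
      · exact (closedBall_subset_ball (by nlinarith)).trans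
          (ball_subset_of_le_infDist_frontier hz' hzd')
      · refine closedBall_subset_ball' ?_
        have := dist_triangle_left z' y z
        rw [hball]
        linarith)
  refine (edist_triangle _ (ballAvg u z' (ε ^ 2 * s / 64)) _).trans
    ((add_le_add hmove hrad).trans ?_)
  rw [← mul_add]
  gcongr
  have hdecomp : ENNReal.ofReal (7 / ε * ((ε ^ 2 / 128) ^ n)⁻¹) *
      (ENNReal.ofReal (s * (s ^ n)⁻¹) * I) =
      (ENNReal.ofReal (6 * s / ε) + ENNReal.ofReal (s / ε)) *
        (ENNReal.ofReal ((ε ^ 2 * s / 128) ^ n)⁻¹ * I) := by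
    rw [← mul_assoc, ← mul_assoc, ← ENNReal.ofReal_mul (by positivity),
      ← ENNReal.ofReal_add (by positivity) (by positivity),
      ← ENNReal.ofReal_mul (by positivity)]
    congr 2
    have hsplit : ε ^ 2 * s / 128 = ε ^ 2 / 128 * s := by ring
    rw [hsplit, mul_pow]
    field_simp
    ring
  rw [hdecomp, add_mul]
  gcongr
  · linarith
  · rw [dist_self, zero_add, abs_of_nonneg (by linarith)]
    linarith

/-- A dyadic version of the Riesz potential of order one. -/
def dyadicPotential {n : ℕ} (M s : ℝ) (g : Euc n → ℝ≥0∞) (y : Euc n) : ℝ≥0∞ :=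
  ∑' k : ℕ, ENNReal.ofReal (s / 2 ^ k * ((s / 2 ^ k) ^ n)⁻¹) *
    ∫⁻ z in ball y (M * (s / 2 ^ k)), g z

theorem IsUniformWith.exists_edist_le_dyadicPotential {n : ℕ} {Ω : Set (Euc n)} {ε : ℝ}
    (hε : 0 < ε) (hε1 : ε ≤ 1) (hOpen : IsOpen Ω) (hΩ : IsUniformWith Ω ε) {u : Euc n → ℝ}
    (hu : LocallyLipschitzOn Ω u) {x : Euc n} (hx : x ∈ Ω) {r : ℝ} (hr : 0 < r)
    (hrd : r < diam Ω) :
    ∃ c : ℝ, ∀ y ∈ ball x r ∩ Ω, edist (u y) c ≤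
      2 * ((volume (ball (0 : Euc n) 1))⁻¹ *
        ENNReal.ofReal (7 / ε * ((ε ^ 2 / 128) ^ n)⁻¹)) *
      dyadicPotential (8 / ε) (r / 4)
        (indicator (ball x ((1 + 2 / ε) * r) ∩ Ω) fun z => ‖fderiv ℝ u z‖ₑ) y := by
  have hpt : ∀ y ∈ Ω, ∀ k : ℕ, ∃ z ∈ Ω, dist y z = r / 4 / 2 ^ k ∧
      ε * (r / 4 / 2 ^ k) / 2 ≤ infDist z (frontier Ω) := fun y hy k => by
    obtain ⟨y', hy', hyy'⟩ := exists_half_le_dist hr hrd y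
    refine hΩ.exists_dist_eq hε hy hy' (by positivity) (le_trans ?_ hyy')
    have : r / 4 / 2 ^ k ≤ r / 4 := div_le_self (by positivity) (one_le_pow₀ one_le_two)
    linarith
  obtain ⟨x₀, hx₀, hxx₀, hdx₀⟩ := hpt x hx 0
  rw [pow_zero, div_one] at hxx₀ hdx₀
  refine ⟨ballAvg u x₀ (ε ^ 2 * (r / 4) / 64), fun y hy => ?_⟩
  choose z hz hyz hdz using hpt y hy.2
  let s : ℕ → ℝ := fun k => r / 4 / 2 ^ k
  have hs : ∀ k, 0 < s k := fun k => by positivity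
  have hs_succ : ∀ k, s (k + 1) = s k / 2 := fun k => by
    simp only [s, pow_succ]
    field_simp
  have hs0 : s 0 = r / 4 := by simp [s]
  have hs_le : ∀ k, s k ≤ r / 4 := fun k =>
    div_le_self (by positivity) (one_le_pow₀ one_le_two)
  set g : Euc n → ℝ≥0∞ := indicator (ball x ((1 + 2 / ε) * r) ∩ Ω) fun z => ‖fderiv ℝ u z‖ₑ
  set κ := (volume (ball (0 : Euc n) 1))⁻¹ * ENNReal.ofReal (7 / ε * ((ε ^ 2 / 128) ^ n)⁻¹)
  let d : ℕ → ℝ≥0∞ := fun k =>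
    ENNReal.ofReal (s k * (s k ^ n)⁻¹) * ∫⁻ z in ball y (8 / ε * s k), g z
  have hgint : ∀ k, ∫⁻ w in Ω ∩ ball y (8 / ε * s k), ‖fderiv ℝ u w‖ₑ ≤
      ∫⁻ w in ball y (8 / ε * s k), g w := fun k => by
    simp only [g]
    rw [setLIntegral_indicator (measurableSet_ball.inter hOpen.measurableSet)]
    refine lintegral_mono_set fun w hw => ⟨⟨?_, hw.1⟩, hw.2⟩
    have h1 := hw.2
    have h2 := hy.1
    rw [mem_ball] at h1 h2 ⊢
    have h3 := dist_triangle w y x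
    have h4 : 8 / ε * s k ≤ 8 / ε * (r / 4) := by
      gcongr
      exact hs_le k
    have h5 : (1 + 2 / ε) * r = r + 8 / ε * (r / 4) := by ring
    linarith
  have hstep : ∀ k, ∀ z' ∈ Ω, ∀ ρ, ε * s k / 4 ≤ infDist z' (frontier Ω) →
      dist (z k) z' ≤ 6 * s k → ε ^ 2 * s k / 128 ≤ ρ → ρ ≤ ε ^ 2 * s k / 64 →
      edist (ballAvg u (z k) (ε ^ 2 * s k / 64)) (ballAvg u z' ρ) ≤ κ * d k := by
    intro k z' hz' ρ h1 h2 h3 h4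
    have hd := hdz k
    have hpos : 0 < ε * s k := mul_pos hε (hs k)
    refine (hΩ.edist_ballAvg_ballAvg_le hε hε1 hOpen hu (y := y) (hs k) (hz k) hz'
      (by change ε * s k / 2 ≤ _ at hd; linarith) h1 (by rw [dist_comm]; exact (hyz k).le)
      h2 h3 h4).trans ?_
    rw [← mul_assoc]
    exact mul_le_mul' le_rfl (mul_le_mul' le_rfl (hgint k))
  have hnext : ∀ k, edist (ballAvg u (z k) (ε ^ 2 * s k / 64))
      (ballAvg u (z (k + 1)) (ε ^ 2 * s (k + 1) / 64)) ≤ κ * d k := fun k => by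
    have hpos : 0 < ε ^ 2 * s k := mul_pos (by positivity) (hs k)
    refine hstep k _ (hz (k + 1)) _ ?_ ?_ ?_ ?_
    · refine le_trans (le_of_eq ?_) (hdz (k + 1))
      change _ = ε * s (k + 1) / 2
      rw [hs_succ]
      ring
    · have := dist_triangle_left (z k) (z (k + 1)) y
      rw [hyz, hyz] at this
      change _ ≤ s k + s (k + 1) at this
      rw [hs_succ] at this
      linarith [hs k]
    · rw [hs_succ]
      linarith
    · rw [hs_succ]
      linarith
  have hlim : Filter.Tendsto (fun k => ballAvg u (z k) (ε ^ 2 * s k / 64)) Filter.atTop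
      (nhds (u y)) := by
    refine tendsto_ballAvg hOpen hu.continuousOn hy.2 (fun k => by have := hs k; positivity)
      (fun k => ?_) ?_
    · refine (closedBall_subset_ball ?_).trans
        (ball_subset_of_le_infDist_frontier (hz k) (hdz k))
      change _ < ε * s k / 2
      have := hs k
      have : ε ^ 2 * s k ≤ ε * s k := by
        gcongr
        nlinarith
      have : 0 < ε * s k := by positivity
      linarith
    · have : Filter.Tendsto s Filter.atTop (nhds 0) := by
        have := (tendsto_pow_atTop_nhds_zero_of_lt_one (r := (1 / 2 : ℝ)) (by norm_num)
          (by norm_num)).const_mul (r / 4)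
        rw [mul_zero] at this
        refine this.congr fun k => ?_
        simp only [s, one_div, inv_pow]
        rfl
      have h2 := (this.add ((this.const_mul (ε ^ 2)).div_const 64))
      simp only [mul_zero, zero_div, add_zero] at h2
      refine h2.congr fun k => ?_
      rw [dist_comm, hyz]
  have htel := edist_le_tsum_of_edist_le_of_tendsto₀ (fun k => κ * d k) hnext hlim
  have hfirst : edist (ballAvg u (z 0) (ε ^ 2 * s 0 / 64))
      (ballAvg u x₀ (ε ^ 2 * (r / 4) / 64)) ≤ κ * d 0 := by
    have hpos : 0 < ε ^ 2 * (r / 4) := by positivity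
    have hpos' : 0 < ε * (r / 4) := by positivity
    refine hstep 0 x₀ hx₀ _ ?_ ?_ ?_ ?_ <;> rw [hs0]
    · linarith
    · have h1 := dist_triangle4 (z 0) y x x₀
      have h2 := hyz 0
      rw [pow_zero, div_one, dist_comm] at h2
      have h3 := hy.1
      rw [mem_ball] at h3
      linarith
    · linarith
  have hd0 : κ * d 0 ≤ ∑' k, κ * d k := ENNReal.le_tsum 0
  calc edist (u y) (ballAvg u x₀ (ε ^ 2 * (r / 4) / 64))
      ≤ edist (ballAvg u (z 0) (ε ^ 2 * s 0 / 64)) (u y) +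
        edist (ballAvg u (z 0) (ε ^ 2 * s 0 / 64)) (ballAvg u x₀ (ε ^ 2 * (r / 4) / 64)) :=
        edist_triangle_left _ _ _
    _ ≤ ∑' k, κ * d k + ∑' k, κ * d k := add_le_add htel (hfirst.trans hd0)
    _ = 2 * κ * dyadicPotential (8 / ε) (r / 4) g y := by
        rw [← two_mul, ENNReal.tsum_mul_left, ← mul_assoc]
        rfl

theorem setLIntegral_setLIntegral_ball_le {n : ℕ} {E : Set (Euc n)} {g : Euc n → ℝ≥0∞}
    (hg : Measurable g) {p : ℝ} (hp : 1 ≤ p) (R : ℝ) :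
    ∫⁻ y in E, ∫⁻ z in ball y R, g z ≤
      (min (volume E) (volume (ball (0 : Euc n) R)) * ∫⁻ z, g z ^ p) ^ (1 / p) *
        (volume E * volume (ball (0 : Euc n) R)) ^ (1 - 1 / p) := by
  have hp0 : 0 < p := by linarith
  have hball : ∀ y : Euc n, volume (ball y R) = volume (ball (0 : Euc n) R) := fun y =>
    Measure.addHaar_ball_center volume y R
  set k : Euc n → Euc n → ℝ≥0∞ := fun y z => indicator (ball y R) 1 z
  have hk : Measurable (Function.uncurry k) := by
    have hS : MeasurableSet {q : Euc n × Euc n | dist q.2 q.1 < R} :=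
      (isOpen_lt (by fun_prop) continuous_const).measurableSet
    exact (measurable_one.indicator hS : Measurable
      ({q : Euc n × Euc n | dist q.2 q.1 < R}.indicator (1 : Euc n × Euc n → ℝ≥0∞)))
  have hksymm : ∀ y z, k y z = k z y := fun y z => by
    simp only [k, indicator, mem_ball, dist_comm, Pi.one_apply]
  have hkint : ∀ y, ∫⁻ z, k y z = volume (ball (0 : Euc n) R) := fun y => by
    rw [← hball y]
    exact lintegral_indicator_one measurableSet_ball
  let w : Euc n → ℝ≥0∞ := fun z => ∫⁻ y in E, k y z
  have hw : Measurable w := hk.lintegral_prod_left'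
  have hw_le : ∀ z, w z ≤ min (volume E) (volume (ball (0 : Euc n) R)) := fun z => by
    simp only [w, hksymm _ z]
    refine le_min ?_ ((setLIntegral_le_lintegral _ _).trans (hkint z).le)
    calc ∫⁻ y in E, k z y ≤ ∫⁻ _ in E, 1 :=
          lintegral_mono fun y => indicator_le_self' (by simp) y
      _ = volume E := by simp
  have hwint : ∫⁻ z, w z = volume E * volume (ball (0 : Euc n) R) := by
    simp only [w]
    rw [← lintegral_lintegral_swap hk.aemeasurable]
    simp only [hkint, setLIntegral_const, mul_comm]
  have hgw : ∫⁻ y in E, ∫⁻ z in ball y R, g z = ∫⁻ z, g z * w z := by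
    have h1 : ∀ y, ∫⁻ z in ball y R, g z = ∫⁻ z, g z * k y z := fun y => by
      rw [← lintegral_indicator measurableSet_ball]
      refine lintegral_congr fun z => ?_
      by_cases hz : z ∈ ball y R <;> simp [k, hz]
    simp only [h1]
    have h2 : Measurable (Function.uncurry fun y z => g z * k y z) :=
      (hg.comp measurable_snd).mul hk
    rw [lintegral_lintegral_swap h2.aemeasurable]
    exact lintegral_congr fun z => lintegral_const_mul _ hk.of_uncurry_right
  have hp1 : 1 / p ≤ 1 := (div_le_one hp0).2 hp
  calc ∫⁻ y in E, ∫⁻ z in ball y R, g z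
      = ∫⁻ z, (w z * g z ^ p) ^ (1 / p) * w z ^ (1 - 1 / p) := by
        rw [hgw]
        refine lintegral_congr fun z => ?_
        rw [ENNReal.mul_rpow_of_nonneg _ _ (by positivity), ← ENNReal.rpow_mul,
          mul_one_div_cancel hp0.ne', ENNReal.rpow_one, mul_right_comm,
          ← ENNReal.rpow_add_of_nonneg _ _ (by positivity) (by linarith), add_sub_cancel,
          ENNReal.rpow_one, mul_comm]
    _ ≤ (∫⁻ z, w z * g z ^ p) ^ (1 / p) * (∫⁻ z, w z) ^ (1 - 1 / p) :=
        ENNReal.lintegral_mul_norm_pow_le (hw.mul (hg.pow_const p)).aemeasurable hw.aemeasurable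
          (by positivity) (by linarith) (by ring)
    _ ≤ _ := by
        rw [hwint, ← lintegral_const_mul _ (hg.pow_const p)]
        gcongr with z
        exact hw_le z

theorem exists_tsum_dyadic_le {b : ℝ} (hb : 1 < b) :
    ∃ C : ℝ≥0, ∀ x : ℝ, 0 < x →
      ∑' k : ℕ, ENNReal.ofReal (x / 2 ^ k * min (x / 2 ^ k)⁻¹ 1 ^ b) ≤ C := by
  let H : ℤ → ℝ := fun j => 2 * min ((2 : ℝ) ^ j) (((2 : ℝ) ^ j) ^ (1 - b))
  have hH0 : ∀ j, 0 ≤ H j := fun j => by positivity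
  have hsum : Summable H := by
    refine Summable.of_nat_of_neg ?_ ?_
    · refine Summable.of_nonneg_of_le (fun j => hH0 j) (fun j => ?_)
        ((summable_geometric_of_lt_one (r := (2 : ℝ) ^ (1 - b)) (by positivity)
          (Real.rpow_lt_one_of_one_lt_of_neg one_lt_two (by linarith))).mul_left 2)
      refine mul_le_mul_of_nonneg_left ((min_le_right _ _).trans_eq ?_) zero_le_two
      rw [zpow_natCast, ← Real.rpow_natCast, ← Real.rpow_natCast, ← Real.rpow_mul zero_le_two,
        ← Real.rpow_mul zero_le_two, mul_comm]
    · refine Summable.of_nonneg_of_le (fun j => hH0 _) (fun j => ?_)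
        ((summable_geometric_of_lt_one (r := (1 / 2 : ℝ)) (by norm_num)
          (by norm_num)).mul_left 2)
      refine mul_le_mul_of_nonneg_left ((min_le_left _ _).trans_eq ?_) zero_le_two
      simp
  have hle : ∀ y : ℝ, ∀ j : ℤ, (2 : ℝ) ^ j ≤ y → y < 2 ^ (j + 1) →
      y * min y⁻¹ 1 ^ b ≤ H j := fun y j h1 h2 => by
    have h2j : (0 : ℝ) < 2 ^ j := by positivity
    have hy : 0 < y := h2j.trans_le h1
    rw [zpow_add_one₀ two_ne_zero] at h2
    simp only [H]
    rw [mul_min_of_nonneg _ _ zero_le_two]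
    refine le_min ?_ ?_
    · have : min y⁻¹ 1 ^ b ≤ 1 := Real.rpow_le_one (by positivity) (min_le_right _ _) (by linarith)
      nlinarith
    · have h3 : min y⁻¹ 1 ^ b ≤ y⁻¹ ^ b :=
        Real.rpow_le_rpow (by positivity) (min_le_left _ _) (by linarith)
      have h4 : y * y⁻¹ ^ b = y ^ (1 - b) := by
        rw [Real.inv_rpow hy.le, Real.rpow_sub hy, Real.rpow_one]
        rfl
      have h5 : y ^ (1 - b) ≤ ((2 : ℝ) ^ j) ^ (1 - b) :=
        Real.rpow_le_rpow_of_nonpos h2j h1 (by linarith)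
      have h6 : 0 ≤ ((2 : ℝ) ^ j) ^ (1 - b) := by positivity
      nlinarith
  refine ⟨(∑' j, ENNReal.ofReal (H j)).toNNReal, fun x hx => ?_⟩
  rw [ENNReal.coe_toNNReal hsum.tsum_ofReal_ne_top]
  obtain ⟨m, hm1, hm2⟩ := _root_.exists_mem_Ico_zpow hx one_lt_two
  refine le_trans (ENNReal.tsum_le_tsum fun k => ENNReal.ofReal_le_ofReal
    (hle (x / 2 ^ k) (m - k) ?_ ?_))
    (ENNReal.tsum_comp_le_tsum_of_injective (f := fun k : ℕ => m - k) (fun a b hab => by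
      simpa using hab) fun j => ENNReal.ofReal (H j))
  · rw [zpow_sub₀ two_ne_zero, zpow_natCast]
    gcongr
  · rw [sub_add_eq_add_sub, zpow_sub₀ two_ne_zero, zpow_natCast]
    gcongr

theorem measurable_setLIntegral_ball {n : ℕ} {g : Euc n → ℝ≥0∞} (hg : Measurable g) (R : ℝ) :
    Measurable fun y : Euc n => ∫⁻ z in ball y R, g z := by
  have hS : MeasurableSet {q : Euc n × Euc n | dist q.2 q.1 < R} :=
    (isOpen_lt (by fun_prop) continuous_const).measurableSet
  have := ((hg.comp measurable_snd).indicator hS).lintegral_prod_right' (ν := volume)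
  refine (congrArg Measurable (funext fun y => ?_)).mp this
  rw [← lintegral_indicator measurableSet_ball]
  rfl

theorem scale_mul_rpow_le {n : ℕ} {p c σ η : ℝ} (hp : 1 ≤ p) (hc : 1 ≤ c) (hσ : 0 < σ)
    (hη : 0 < η) :
    σ * (σ ^ n)⁻¹ * (min (η ^ n) (c * σ ^ n) ^ (1 / p) * (η ^ n * (c * σ ^ n)) ^ (1 - 1 / p)) ≤
      c * (η * (η ^ n) ^ (1 - 1 / p)) * (σ / η * min (σ / η)⁻¹ 1 ^ (n / p)) := by
  have hp0 : 0 < p := by linarith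
  have hp1 : 1 / p ≤ 1 := (div_le_one hp0).2 hp
  set μ := min (σ / η)⁻¹ 1
  have hμ : 0 < μ := by positivity
  have hmin : min (η ^ n) (c * σ ^ n) ≤ c * (σ ^ n * μ ^ n) := by
    rcases min_choice (σ / η)⁻¹ 1 with h | h
    · refine (min_le_left _ _).trans ?_
      have : σ * μ = η := by
        change σ * min (σ / η)⁻¹ 1 = η
        rw [h]
        field_simp
      rw [← mul_pow, this]
      nlinarith [pow_pos hη n]
    · refine (min_le_right _ _).trans ?_
      change _ ≤ c * (σ ^ n * min (σ / η)⁻¹ 1 ^ n)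
      rw [h, one_pow, mul_one]
  have h1 : min (η ^ n) (c * σ ^ n) ^ (1 / p) ≤
      c ^ (1 / p) * ((σ ^ n) ^ (1 / p) * μ ^ (n / p)) := by
    refine (Real.rpow_le_rpow (by positivity) hmin (by positivity)).trans_eq ?_
    rw [Real.mul_rpow (by positivity) (by positivity), Real.mul_rpow (by positivity)
      (by positivity), ← Real.rpow_natCast μ, ← Real.rpow_mul hμ.le, mul_one_div]
  have h2 : (η ^ n * (c * σ ^ n)) ^ (1 - 1 / p) =
      (η ^ n) ^ (1 - 1 / p) * (c ^ (1 - 1 / p) * (σ ^ n) ^ (1 - 1 / p)) := by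
    rw [Real.mul_rpow (by positivity) (by positivity), Real.mul_rpow (by positivity)
      (by positivity)]
  have hsplit : ∀ a : ℝ, 0 < a → a ^ (1 / p) * a ^ (1 - 1 / p) = a := fun a ha => by
    rw [← Real.rpow_add ha, add_sub_cancel, Real.rpow_one]
  have hc' := hsplit c (by linarith)
  have hσ' := hsplit (σ ^ n) (by positivity)
  calc _ ≤ σ * (σ ^ n)⁻¹ * (c ^ (1 / p) * ((σ ^ n) ^ (1 / p) * μ ^ (n / p)) *
        ((η ^ n) ^ (1 - 1 / p) * (c ^ (1 - 1 / p) * (σ ^ n) ^ (1 - 1 / p)))) := by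
        rw [h2]
        gcongr
    _ = σ * (σ ^ n)⁻¹ * ((c ^ (1 / p) * c ^ (1 - 1 / p)) *
        ((σ ^ n) ^ (1 / p) * (σ ^ n) ^ (1 - 1 / p)) * (η ^ n) ^ (1 - 1 / p) * μ ^ (n / p)) := by
        ring
    _ = _ := by
        rw [hc', hσ']
        field_simp

theorem exists_setLIntegral_dyadicPotential_le {n : ℕ} {p M : ℝ} (hp : 1 ≤ p) (hpn : p < n)
    (hM : 0 ≤ M) :
    ∃ C : ℝ≥0, ∀ s : ℝ, 0 < s → ∀ g : Euc n → ℝ≥0∞, Measurable g → ∀ E : Set (Euc n),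
      volume E ≠ ⊤ → ∫⁻ y in E, dyadicPotential M s g y ≤
        C * (∫⁻ z, g z ^ p) ^ (1 / p) * volume E ^ (1 - 1 / p + 1 / n) := by
  have hp0 : 0 < p := by linarith
  have hp1 : 1 / p ≤ 1 := (div_le_one hp0).2 hp
  have hn : (0 : ℝ) < n := by linarith
  have hn' : n ≠ 0 := by rintro rfl; simp at hn
  have : Nontrivial (Euc n) := by
    have : Nonempty (Fin n) := ⟨⟨0, Nat.pos_of_ne_zero hn'⟩⟩
    infer_instance
  obtain ⟨B, hB⟩ := exists_tsum_dyadic_le (b := n / p) ((one_lt_div hp0).2 hpn)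
  set c : ℝ := max 1 (M ^ n * (volume (ball (0 : Euc n) 1)).toReal)
  have hc : 1 ≤ c := le_max_left _ _
  refine ⟨c.toNNReal * B, fun s hs g hg E hE => ?_⟩
  rcases eq_or_ne (volume E) 0 with h0 | h0
  · rw [Measure.restrict_eq_zero.2 h0, lintegral_zero_measure]
    exact zero_le
  set G := (∫⁻ z, g z ^ p) ^ (1 / p)
  set η : ℝ := (volume E).toReal ^ (1 / n : ℝ) with hη_def
  have hη : 0 < η := Real.rpow_pos_of_pos (ENNReal.toReal_pos h0 hE) _
  have hEη : volume E = ENNReal.ofReal (η ^ n) := by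
    rw [hη_def, ← Real.rpow_natCast, ← Real.rpow_mul ENNReal.toReal_nonneg,
      one_div_mul_cancel hn.ne', Real.rpow_one, ENNReal.ofReal_toReal hE]
  have hvol : ∀ σ, 0 < σ → volume (ball (0 : Euc n) (M * σ)) ≤ ENNReal.ofReal (c * σ ^ n) :=
    fun σ hσ => by
    rw [Measure.addHaar_ball _ _ (by positivity), finrank_euclideanSpace_fin,
      ← ENNReal.ofReal_toReal (a := volume (ball (0 : Euc n) 1)) measure_ball_lt_top.ne,
      ← ENNReal.ofReal_mul (by positivity)]
    refine ENNReal.ofReal_le_ofReal ?_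
    have h1 : M ^ n * (volume (ball (0 : Euc n) 1)).toReal ≤ c := le_max_right _ _
    have h2 : 0 < σ ^ n := by positivity
    rw [mul_pow]
    nlinarith
  have hterm : ∀ k : ℕ, ENNReal.ofReal (s / 2 ^ k * ((s / 2 ^ k) ^ n)⁻¹) *
      ∫⁻ y in E, ∫⁻ z in ball y (M * (s / 2 ^ k)), g z ≤
      ENNReal.ofReal (c * (η * (η ^ n) ^ (1 - 1 / p))) * G *
        ENNReal.ofReal (s / η / 2 ^ k * min (s / η / 2 ^ k)⁻¹ 1 ^ (n / p)) := fun k => by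
    set σ := s / 2 ^ k
    have hσ : 0 < σ := by positivity
    have hσe : s / η / 2 ^ k = σ / η := by
      simp only [σ]
      field_simp
    calc _ ≤ ENNReal.ofReal (σ * (σ ^ n)⁻¹) *
          ((min (ENNReal.ofReal (η ^ n)) (ENNReal.ofReal (c * σ ^ n)) *
            ∫⁻ z, g z ^ p) ^ (1 / p) *
          (ENNReal.ofReal (η ^ n) * ENNReal.ofReal (c * σ ^ n)) ^ (1 - 1 / p)) := by
          gcongr
          refine (setLIntegral_setLIntegral_ball_le hg hp _).trans ?_
          rw [hEη]
          gcongr <;> exact hvol σ hσ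
      _ = ENNReal.ofReal (σ * (σ ^ n)⁻¹ * (min (η ^ n) (c * σ ^ n) ^ (1 / p) *
            (η ^ n * (c * σ ^ n)) ^ (1 - 1 / p))) * G := by
          rw [ENNReal.mul_rpow_of_nonneg _ _ (by positivity), ← ENNReal.ofReal_min,
            ENNReal.ofReal_rpow_of_nonneg (by positivity) (by positivity),
            ← ENNReal.ofReal_mul (by positivity),
            ENNReal.ofReal_rpow_of_nonneg (by positivity) (by linarith),
            ENNReal.ofReal_mul (p := σ * (σ ^ n)⁻¹) (by positivity),
            ENNReal.ofReal_mul (p := min (η ^ n) (c * σ ^ n) ^ (1 / p)) (by positivity)]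
          ring
      _ ≤ ENNReal.ofReal (c * (η * (η ^ n) ^ (1 - 1 / p)) *
            (σ / η * min (σ / η)⁻¹ 1 ^ (n / p))) * G := by
          exact mul_le_mul' (ENNReal.ofReal_le_ofReal (scale_mul_rpow_le hp hc hσ hη)) le_rfl
      _ = _ := by
          rw [hσe, ENNReal.ofReal_mul (by positivity)]
          ring
  have hEpow : volume E ^ (1 - 1 / p + 1 / n) = ENNReal.ofReal (η * (η ^ n) ^ (1 - 1 / p)) := by
    have h1n : (η ^ n) ^ (1 / n : ℝ) = η := by
      rw [← Real.rpow_natCast, ← Real.rpow_mul hη.le, mul_one_div_cancel hn.ne', Real.rpow_one]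
    rw [hEη, ENNReal.ofReal_rpow_of_pos (by positivity), Real.rpow_add (by positivity), h1n,
      mul_comm]
  calc ∫⁻ y in E, dyadicPotential M s g y
      = ∑' k : ℕ, ENNReal.ofReal (s / 2 ^ k * ((s / 2 ^ k) ^ n)⁻¹) *
          ∫⁻ y in E, ∫⁻ z in ball y (M * (s / 2 ^ k)), g z := by
        simp only [dyadicPotential]
        rw [lintegral_tsum fun k => ((measurable_setLIntegral_ball hg _).const_mul _).aemeasurable]
        exact tsum_congr fun k => lintegral_const_mul _ (measurable_setLIntegral_ball hg _)
    _ ≤ ∑' k : ℕ, ENNReal.ofReal (c * (η * (η ^ n) ^ (1 - 1 / p))) * G *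
        ENNReal.ofReal (s / η / 2 ^ k * min (s / η / 2 ^ k)⁻¹ 1 ^ (n / p)) :=
        ENNReal.tsum_le_tsum hterm
    _ ≤ ENNReal.ofReal (c * (η * (η ^ n) ^ (1 - 1 / p))) * G * B := by
        rw [ENNReal.tsum_mul_left]
        gcongr
        exact hB _ (by positivity)
    _ = _ := by
        rw [hEpow, ENNReal.ofReal_mul (by positivity), ENNReal.coe_mul]
        change ENNReal.ofReal c * _ * _ * _ = ENNReal.ofReal c * _ * _ * _
        ring

/-- A weak-type estimate for functions dominated by a dyadic potential. -/
theorem exists_mul_measure_rpow_le {n : ℕ} {p M : ℝ} (hp : 1 ≤ p) (hpn : p < n)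
    (hM : 0 ≤ M) :
    ∃ C : ℝ≥0, ∀ s : ℝ, 0 < s → ∀ g : Euc n → ℝ≥0∞, Measurable g → ∀ E : Set (Euc n),
      MeasurableSet E → volume E ≠ ⊤ → ∀ t K : ℝ≥0∞, K ≠ ⊤ →
        (∀ y ∈ E, t ≤ K * dyadicPotential M s g y) →
        t * volume E ^ (1 / p - 1 / n) ≤ K * (C * (∫⁻ z, g z ^ p) ^ (1 / p)) := by
  obtain ⟨C, hC⟩ := exists_setLIntegral_dyadicPotential_le hp hpn hM
  refine ⟨C, fun s hs g hg E hEm hE t K hK ht => ?_⟩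
  have hp0 : 0 < p := by linarith
  have hq : 0 < 1 / p - 1 / n := sub_pos.2 (one_div_lt_one_div_of_lt hp0 hpn)
  rcases eq_or_ne (volume E) 0 with h0 | h0
  · rw [h0, ENNReal.zero_rpow_of_pos hq, mul_zero]
    exact zero_le
  have h1 : t * volume E ≤
      K * (C * (∫⁻ z, g z ^ p) ^ (1 / p)) * volume E ^ (1 - 1 / p + 1 / n) := by
    rw [← setLIntegral_const, mul_assoc]
    refine (setLIntegral_mono' hEm ht).trans ?_
    rw [lintegral_const_mul' _ _ hK]
    exact mul_le_mul' le_rfl (hC s hs g hg E hE)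
  have h2 : volume E = volume E ^ (1 / p - 1 / n) * volume E ^ (1 - 1 / p + 1 / n) := by
    rw [← ENNReal.rpow_add _ _ h0 hE]
    ring_nf
    rw [ENNReal.rpow_one]
  rw [h2, ← mul_assoc, ← h2] at h1
  exact (ENNReal.mul_le_mul_iff_left (by simp [h0, hE]) (by simp [h0, hE])).1 h1

theorem ContinuousOn.measurableSet_inter_preimage {n : ℕ} {u : Euc n → ℝ} {Ω : Set (Euc n)}
    (hOpen : IsOpen Ω) (hu : ContinuousOn u Ω) {S : Set ℝ} (hS : MeasurableSet S) :
    MeasurableSet (Ω ∩ u ⁻¹' S) := by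
  classical
  have hm : Measurable (Ω.piecewise u fun _ => 0) :=
    hu.measurable_piecewise continuousOn_const hOpen.measurableSet
  have : Ω ∩ u ⁻¹' S = Ω ∩ (Ω.piecewise u fun _ => 0) ⁻¹' S := by
    ext y
    simp only [mem_inter_iff, mem_preimage, and_congr_right_iff]
    intro hy
    rw [piecewise_eq_of_mem _ _ _ hy]
  rw [this]
  exact hOpen.measurableSet.inter (hm hS)

theorem LocallyLipschitzOn.truncate {n : ℕ} {u : Euc n → ℝ} {Ω : Set (Euc n)}
    (hu : LocallyLipschitzOn Ω u) (a b : ℝ) :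
    LocallyLipschitzOn Ω fun y => max a (min (u y) b) := by
  intro x hx
  obtain ⟨K, t, ht, hK⟩ := hu hx
  refine ⟨K, t, ht, LipschitzOnWith.of_dist_le_mul fun y hy z hz => ?_⟩
  refine le_trans ?_ (hK.dist_le_mul y hy z hz)
  rw [Real.dist_eq, Real.dist_eq]
  refine (abs_max_sub_max_le_max _ _ _ _).trans (max_le (by simp) ?_)
  exact (abs_min_sub_min_le_max _ _ _ _).trans (max_le le_rfl (by simp))

theorem enorm_fderiv_truncate_le {n : ℕ} {u : Euc n → ℝ} {Ω : Set (Euc n)} (hOpen : IsOpen Ω)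
    (hu : ContinuousOn u Ω) {a b : ℝ} (hab : a ≤ b) {y : Euc n} (hy : y ∈ Ω) :
    ‖fderiv ℝ (fun z => max a (min (u z) b)) y‖ₑ ≤
      indicator (u ⁻¹' Ioo a b) (fun z => ‖fderiv ℝ u z‖ₑ) y := by
  rcases le_or_gt (u y) a with ha | ha
  · have hmin : IsLocalMin (fun z => max a (min (u z) b)) y := Filter.Eventually.of_forall
      fun z => by simp [ha, ha.trans hab]
    rw [hmin.fderiv_eq_zero, ← ofReal_norm, norm_zero, ENNReal.ofReal_zero]
    exact zero_le
  rcases le_or_gt b (u y) with hb | hb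
  · have hmax : IsLocalMax (fun z => max a (min (u z) b)) y := Filter.Eventually.of_forall
      fun z => by simp [hb, hab]
    rw [hmax.fderiv_eq_zero, ← ofReal_norm, norm_zero, ENNReal.ofReal_zero]
    exact zero_le
  · rw [indicator_of_mem (show y ∈ u ⁻¹' Ioo a b from ⟨ha, hb⟩)]
    refine (congrArg _ (Filter.EventuallyEq.fderiv_eq ?_)).le
    filter_upwards [(hu.continuousAt (hOpen.mem_nhds hy)).eventually (Ioo_mem_nhds ha hb)]
      with z hz
    rw [min_eq_left hz.2.le, max_eq_right hz.1.le]

theorem IsUniformWith.exists_weak_le {n : ℕ} {Ω : Set (Euc n)} {ε : ℝ} (hε : 0 < ε)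
    (hε1 : ε ≤ 1) (hOpen : IsOpen Ω) (hΩ : IsUniformWith Ω ε) {p : ℝ} (hp : 1 ≤ p)
    (hpn : p < n) :
    ∃ C : ℝ≥0, ∀ u : Euc n → ℝ, LocallyLipschitzOn Ω u → ∀ x ∈ Ω, ∀ r : ℝ, 0 < r →
      r < diam Ω → ∃ c : ℝ, ∀ t : ℝ,
        ENNReal.ofReal t * volume (ball x r ∩ Ω ∩ {y | t ≤ |u y - c|}) ^ (1 / p - 1 / n) ≤
          C * (∫⁻ y in ball x ((1 + 2 / ε) * r) ∩ Ω, ‖fderiv ℝ u y‖ₑ ^ p) ^ (1 / p) := by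
  have hp0 : 0 < p := by linarith
  obtain ⟨C, hC⟩ := exists_mul_measure_rpow_le (n := n) (M := 8 / ε) hp hpn (by positivity)
  set K : ℝ≥0∞ := 2 * ((volume (ball (0 : Euc n) 1))⁻¹ *
        ENNReal.ofReal (7 / ε * ((ε ^ 2 / 128) ^ n)⁻¹))
  have hK : K ≠ ⊤ := ENNReal.mul_ne_top ENNReal.ofNat_ne_top (ENNReal.mul_ne_top
    (ENNReal.inv_ne_top.2 (measure_ball_pos _ _ one_pos).ne') ENNReal.ofReal_ne_top)
  refine ⟨K.toNNReal * C, fun u hu x hx r hr hrd => ?_⟩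
  obtain ⟨c, hc⟩ := hΩ.exists_edist_le_dyadicPotential hε hε1 hOpen hu hx hr hrd
  refine ⟨c, fun t => ?_⟩
  set A := ball x ((1 + 2 / ε) * r) ∩ Ω
  have hA : MeasurableSet A := measurableSet_ball.inter hOpen.measurableSet
  have hE : MeasurableSet (ball x r ∩ Ω ∩ {y | t ≤ |u y - c|}) := by
    rw [inter_assoc]
    exact measurableSet_ball.inter (hu.continuousOn.measurableSet_inter_preimage hOpen
      (S := {v | t ≤ |v - c|}) (measurableSet_le (by fun_prop) (by fun_prop)))
  have hfin : volume (ball x r ∩ Ω ∩ {y | t ≤ |u y - c|}) ≠ ⊤ :=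
    measure_ne_top_of_subset (inter_subset_left.trans inter_subset_left) measure_ball_lt_top.ne
  have hg : Measurable (A.indicator fun z => ‖fderiv ℝ u z‖ₑ) :=
    (measurable_fderiv ℝ u).enorm.indicator hA
  have h := hC (r / 4) (by positivity) _ hg _ hE hfin (ENNReal.ofReal t) K hK fun y hy => by
    refine le_trans ?_ (hc y hy.1)
    rw [edist_dist, Real.dist_eq]
    exact ENNReal.ofReal_le_ofReal hy.2
  have hpow : ∫⁻ z, A.indicator (fun z => ‖fderiv ℝ u z‖ₑ) z ^ p =
      ∫⁻ z in A, ‖fderiv ℝ u z‖ₑ ^ p := by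
    rw [← lintegral_indicator hA]
    refine lintegral_congr fun z => ?_
    by_cases hz : z ∈ A <;> simp [hz, hp0]
  rwa [hpow, ← mul_assoc, ← ENNReal.coe_toNNReal hK, ← ENNReal.coe_mul] at h

/-- Capacitary-type estimate obtained by truncation. -/
theorem IsUniformWith.exists_superlevel_le {n : ℕ} {Ω : Set (Euc n)} {ε : ℝ} (hε : 0 < ε)
    (hε1 : ε ≤ 1) (hOpen : IsOpen Ω) (hΩ : IsUniformWith Ω ε) {p : ℝ} (hp : 1 ≤ p)
    (hpn : p < n) :
    ∃ C : ℝ≥0, ∀ u : Euc n → ℝ, LocallyLipschitzOn Ω u → ∀ x ∈ Ω, ∀ r : ℝ, 0 < r →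
      r < diam Ω → ∀ a b : ℝ, a < b →
        volume (ball x r ∩ Ω ∩ {y | b ≤ u y}) ≤ volume (ball x r ∩ Ω ∩ {y | u y ≤ a}) →
        ENNReal.ofReal (b - a) * volume (ball x r ∩ Ω ∩ {y | b ≤ u y}) ^ (1 / p - 1 / n) ≤
          C * (∫⁻ y in ball x ((1 + 2 / ε) * r) ∩ (Ω ∩ u ⁻¹' Ioo a b),
            ‖fderiv ℝ u y‖ₑ ^ p) ^ (1 / p) := by
  have hp0 : 0 < p := by linarith
  have hq : 0 < 1 / p - 1 / n := sub_pos.2 (one_div_lt_one_div_of_lt hp0 hpn)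
  obtain ⟨C, hC⟩ := hΩ.exists_weak_le hε hε1 hOpen hp hpn
  refine ⟨2 * C, fun u hu x hx r hr hrd a b hab hvol => ?_⟩
  obtain ⟨c, hc⟩ := hC _ (hu.truncate a b) x hx r hr hrd
  have hgint : ∫⁻ y in ball x ((1 + 2 / ε) * r) ∩ Ω,
      ‖fderiv ℝ (fun z => max a (min (u z) b)) y‖ₑ ^ p ≤
      ∫⁻ y in ball x ((1 + 2 / ε) * r) ∩ (Ω ∩ u ⁻¹' Ioo a b), ‖fderiv ℝ u y‖ₑ ^ p := by
    have hm : MeasurableSet (Ω ∩ u ⁻¹' Ioo a b) :=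
      hu.continuousOn.measurableSet_inter_preimage hOpen measurableSet_Ioo
    rw [inter_comm (ball x ((1 + 2 / ε) * r)) (Ω ∩ _), ← setLIntegral_indicator hm]
    refine (setLIntegral_mono' (measurableSet_ball.inter hOpen.measurableSet) fun y hy => ?_).trans
      (lintegral_mono_set inter_subset_left)
    refine (ENNReal.rpow_le_rpow (enorm_fderiv_truncate_le hOpen hu.continuousOn hab.le hy.2)
      hp0.le).trans ?_
    by_cases hyab : y ∈ u ⁻¹' Ioo a b
    · rw [indicator_of_mem hyab, indicator_of_mem (mem_inter hy.2 hyab)]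
    · rw [indicator_of_notMem hyab, ENNReal.zero_rpow_of_pos hp0]
      exact zero_le
  have hvol' : volume (ball x r ∩ Ω ∩ {y | b ≤ u y}) ≤
      volume (ball x r ∩ Ω ∩ {y | (b - a) / 2 ≤ |max a (min (u y) b) - c|}) := by
    rcases le_total ((a + b) / 2) c with h | h
    · refine hvol.trans (measure_mono fun y hy => ⟨hy.1, ?_⟩)
      have hya : u y ≤ a := hy.2
      change _ ≤ |max a (min (u y) b) - c|
      rw [min_eq_left (hya.trans hab.le), max_eq_left hya, abs_sub_comm]
      exact le_trans (by linarith) (le_abs_self _)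
    · refine measure_mono fun y hy => ⟨hy.1, ?_⟩
      have hyb : b ≤ u y := hy.2
      change _ ≤ |max a (min (u y) b) - c|
      rw [min_eq_right hyb, max_eq_right hab.le]
      exact le_trans (by linarith) (le_abs_self _)
  have htwo : ENNReal.ofReal (b - a) = 2 * ENNReal.ofReal ((b - a) / 2) := by
    rw [← ENNReal.ofReal_ofNat, ← ENNReal.ofReal_mul zero_le_two, mul_div_cancel₀ _ two_ne_zero]
  calc _ ≤ 2 * (ENNReal.ofReal ((b - a) / 2) * volume (ball x r ∩ Ω ∩
          {y | (b - a) / 2 ≤ |max a (min (u y) b) - c|}) ^ (1 / p - 1 / n)) := by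
        rw [htwo, mul_assoc]
        gcongr
    _ ≤ 2 * (C * (∫⁻ y in ball x ((1 + 2 / ε) * r) ∩ (Ω ∩ u ⁻¹' Ioo a b),
          ‖fderiv ℝ u y‖ₑ ^ p) ^ (1 / p)) := by
        exact mul_le_mul' le_rfl ((hc _).trans (by gcongr))
    _ = _ := by
        rw [ENNReal.coe_mul, mul_assoc]
        rfl

theorem exists_median {α : Type*} [MeasurableSpace α] (μ : Measure α) [IsFiniteMeasure μ]
    {f : α → ℝ} (hf : AEMeasurable f μ) :
    ∃ m : ℝ, (∀ t, m < t → μ {y | t < f y} ≤ μ {y | f y ≤ t}) ∧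
      ∀ t, t < m → μ {y | f y ≤ t} ≤ μ {y | t < f y} := by
  rcases eq_or_ne (μ univ) 0 with h0 | h0
  · have : μ = 0 := Measure.measure_univ_eq_zero.1 h0
    exact ⟨0, by simp [this]⟩
  set ν := μ.map f with hν_def
  have hν0 : ν univ ≠ 0 := by rwa [hν_def, Measure.map_apply_of_aemeasurable hf .univ]
  have hνtop : ν univ ≠ ⊤ := measure_ne_top _ _
  have hle : ∀ t, μ {y | f y ≤ t} = ν (Iic t) := fun t =>
    (Measure.map_apply_of_aemeasurable hf measurableSet_Iic).symm
  have hgt : ∀ t, μ {y | t < f y} = ν (Ioi t) := fun t =>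
    (Measure.map_apply_of_aemeasurable hf measurableSet_Ioi).symm
  have hadd : ∀ t, ν (Iic t) + ν (Ioi t) = ν univ := fun t => by
    rw [← compl_Iic, measure_add_measure_compl measurableSet_Iic]
  let T : Set ℝ := {t | ν univ / 2 ≤ ν (Iic t)}
  have hT : T.Nonempty := by
    obtain ⟨t, ht⟩ := ((tendsto_measure_Iic_atTop ν).eventually_const_lt
      (ENNReal.half_lt_self hν0 hνtop)).exists
    exact ⟨t, ht.le⟩
  have hTb : BddBelow T := by
    obtain ⟨t, ht⟩ := ((tendsto_measure_Ici_atBot ν).eventually_const_lt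
      (ENNReal.half_lt_self hν0 hνtop)).exists
    refine ⟨t, fun s hs => le_of_not_gt fun hst => ?_⟩
    have h1 := ENNReal.add_lt_add_of_le_of_lt (ENNReal.div_ne_top hνtop two_ne_zero) hs
      (ht.trans_le (measure_mono (Ici_subset_Ioi.2 hst)))
    rw [ENNReal.add_halves, hadd] at h1
    exact h1.false
  have hsplit : ∀ t, ν univ / 2 ≤ ν (Iic t) → ν (Ioi t) ≤ ν univ / 2 := fun t ht => by
    by_contra! hcon
    have h1 := ENNReal.add_lt_add_of_le_of_lt (ENNReal.div_ne_top hνtop two_ne_zero) ht hcon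
    rw [ENNReal.add_halves, hadd] at h1
    exact h1.false
  refine ⟨sInf T, fun t ht => ?_, fun t ht => ?_⟩
  · rw [hle, hgt]
    obtain ⟨s, hs, hst⟩ := exists_lt_of_csInf_lt hT ht
    have h1 : ν univ / 2 ≤ ν (Iic t) := le_trans hs (measure_mono (Iic_subset_Iic.2 hst.le))
    exact (hsplit t h1).trans h1
  · rw [hle, hgt]
    have h1 : ν (Iic t) < ν univ / 2 := lt_of_not_ge fun h => notMem_of_lt_csInf ht hTb h
    refine h1.le.trans ?_
    by_contra! hcon
    have h2 := ENNReal.add_lt_add h1 hcon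
    rw [ENNReal.add_halves, hadd] at h2
    exact h2.false

theorem ENNReal.tsum_rpow_le_rpow_tsum {ι : Type*} (a : ι → ℝ≥0∞) {θ : ℝ} (hθ : 1 ≤ θ) :
    ∑' i, a i ^ θ ≤ (∑' i, a i) ^ θ := by
  have hsplit : ∀ c : ℝ≥0∞, c ^ θ = c * c ^ (θ - 1) := fun c => by
    conv_rhs => rw [← ENNReal.rpow_one c, ← ENNReal.rpow_mul, one_mul,
      ← ENNReal.rpow_add_of_nonneg _ _ zero_le_one (by linarith), add_sub_cancel]
  rw [hsplit (∑' i, a i), ← ENNReal.tsum_mul_right]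
  refine ENNReal.tsum_le_tsum fun i => ?_
  rw [hsplit]
  exact mul_le_mul' le_rfl (ENNReal.rpow_le_rpow (ENNReal.le_tsum i) (by linarith))

theorem lintegral_ofReal_rpow_le_tsum {α : Type*} [MeasurableSpace α] (μ : Measure α) {w : α → ℝ}
    (hw : AEMeasurable w μ) {q : ℝ} (hq : 0 < q) :
    ∫⁻ y, ENNReal.ofReal (w y) ^ q ∂μ ≤
      ∑' j : ℤ, ENNReal.ofReal (2 ^ (j + 1)) ^ q * μ {y | (2 : ℝ) ^ j ≤ w y} := by
  have hS : ∀ j : ℤ, NullMeasurableSet {y | (2 : ℝ) ^ j ≤ w y} μ := fun j =>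
    nullMeasurableSet_le aemeasurable_const hw
  calc ∫⁻ y, ENNReal.ofReal (w y) ^ q ∂μ
      ≤ ∫⁻ y, ∑' j : ℤ, {y | (2 : ℝ) ^ j ≤ w y}.indicator
          (fun _ => ENNReal.ofReal (2 ^ (j + 1)) ^ q) y ∂μ := by
        refine lintegral_mono fun y => ?_
        rcases le_or_gt (w y) 0 with h | h
        · simp [ENNReal.ofReal_of_nonpos h, hq]
        · obtain ⟨j, hj1, hj2⟩ := _root_.exists_mem_Ico_zpow h one_lt_two
          refine le_trans ?_ (ENNReal.le_tsum j)
          rw [indicator_of_mem (show y ∈ {y | (2 : ℝ) ^ j ≤ w y} from hj1)]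
          gcongr
    _ = _ := by
        rw [lintegral_tsum fun j => aemeasurable_const.indicator₀ (hS j)]
        exact tsum_congr fun j => lintegral_indicator_const₀ (hS j) _

theorem IsUniformWith.exists_lintegral_pos_part_le {n : ℕ} {Ω : Set (Euc n)} {ε : ℝ} (hε : 0 < ε)
    (hε1 : ε ≤ 1) (hOpen : IsOpen Ω) (hΩ : IsUniformWith Ω ε) {p : ℝ} (hp : 1 ≤ p)
    (hpn : p < n) {q : ℝ} (hq : 1 / q = 1 / p - 1 / n) :
    ∃ C : ℝ≥0, ∀ u : Euc n → ℝ, LocallyLipschitzOn Ω u → ∀ x ∈ Ω, ∀ r : ℝ, 0 < r →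
      r < diam Ω → ∀ m : ℝ, (∀ t, m < t →
        volume (ball x r ∩ Ω ∩ {y | t < u y}) ≤ volume (ball x r ∩ Ω ∩ {y | u y ≤ t})) →
        ∫⁻ y in ball x r ∩ Ω, ENNReal.ofReal (u y - m) ^ q ≤
          C * (∫⁻ y in ball x ((1 + 2 / ε) * r) ∩ Ω, ‖fderiv ℝ u y‖ₑ ^ p) ^ (q / p) := by
  have hp0 : 0 < p := by linarith
  have hn : (0 : ℝ) < n := by linarith
  have hq0 : 0 < q := by
    rw [← one_div_pos, hq]
    exact sub_pos.2 (one_div_lt_one_div_of_lt hp0 hpn)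
  have hpq : 1 ≤ q / p := by
    rw [one_le_div hp0, ← one_div_le_one_div hq0 hp0, hq]
    linarith [one_div_pos.2 hn]
  obtain ⟨C, hC⟩ := hΩ.exists_superlevel_le hε hε1 hOpen hp hpn
  refine ⟨(4 * C) ^ q, fun u hu x hx r hr hrd m hm => ?_⟩
  have hD : MeasurableSet (ball x r ∩ Ω) := measurableSet_ball.inter hOpen.measurableSet
  have huD : AEMeasurable (fun y => u y - m) (volume.restrict (ball x r ∩ Ω)) :=
    ((hu.continuousOn.mono inter_subset_right).aemeasurable hD).sub_const m
  let S : ℤ → Set (Euc n) := fun j => ball x ((1 + 2 / ε) * r) ∩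
    (Ω ∩ u ⁻¹' Ioo (m + 2 ^ (j - 1)) (m + 2 ^ j))
  have hS : ∀ j, MeasurableSet (S j) := fun j => measurableSet_ball.inter
    (hu.continuousOn.measurableSet_inter_preimage hOpen measurableSet_Ioo)
  have hSdisj : Pairwise (Function.onFun Disjoint S) := by
    refine (pairwise_disjoint_on S).2 fun i j hij => disjoint_left.2 fun y hyi hyj => ?_
    have h1 := hyi.2.2.2
    have h2 := hyj.2.2.1
    have h3 : (2 : ℝ) ^ i ≤ 2 ^ (j - 1) := zpow_le_zpow_right₀ one_le_two (by omega)
    linarith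
  have hlevel : ∀ j : ℤ, ENNReal.ofReal (2 ^ (j + 1)) ^ q *
      volume.restrict (ball x r ∩ Ω) {y | (2 : ℝ) ^ j ≤ u y - m} ≤
      (4 * C : ℝ≥0∞) ^ q * (∫⁻ y in S j, ‖fderiv ℝ u y‖ₑ ^ p) ^ (q / p) := fun j => by
    have hj : (2 : ℝ) ^ j = 2 * 2 ^ (j - 1) := by
      rw [← zpow_one_add₀ two_ne_zero]
      ring_nf
    have hj' : (2 : ℝ) ^ (j + 1) = 4 * (m + 2 ^ j - (m + 2 ^ (j - 1))) := by
      rw [zpow_add_one₀ two_ne_zero, hj]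
      ring
    have hpos : (0 : ℝ) < 2 ^ (j - 1) := by positivity
    have hset : {y | (2 : ℝ) ^ j ≤ u y - m} = {y | m + 2 ^ j ≤ u y} := by
      ext y
      simp only [mem_ofPred_eq]
      exact le_sub_iff_add_le'
    have h := hC u hu x hx r hr hrd (m + 2 ^ (j - 1)) (m + 2 ^ j) (by linarith)
      ((measure_mono (inter_subset_inter_right _ fun y hy => by
        have hy' : m + 2 ^ j ≤ u y := hy
        change _ < u y
        linarith)).trans (hm _ (by linarith)))
    rw [Measure.restrict_apply' hD, inter_comm, hset, hj', ENNReal.ofReal_mul (by norm_num),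
      ENNReal.ofReal_ofNat]
    have hpow := ENNReal.rpow_le_rpow (mul_le_mul' (le_refl (4 : ℝ≥0∞)) h) hq0.le
    rw [← hq, ← mul_assoc, ← mul_assoc, ENNReal.mul_rpow_of_nonneg _ _ hq0.le, ← ENNReal.rpow_mul,
      one_div_mul_cancel hq0.ne', ENNReal.rpow_one,
      ENNReal.mul_rpow_of_nonneg (4 * (C : ℝ≥0∞)) _ hq0.le,
      ← ENNReal.rpow_mul, one_div_mul_eq_div] at hpow
    exact hpow
  calc _ ≤ ∑' j : ℤ, ENNReal.ofReal (2 ^ (j + 1)) ^ q *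
        volume.restrict (ball x r ∩ Ω) {y | (2 : ℝ) ^ j ≤ u y - m} :=
        lintegral_ofReal_rpow_le_tsum _ huD hq0
    _ ≤ ∑' j : ℤ, (4 * C : ℝ≥0∞) ^ q * (∫⁻ y in S j, ‖fderiv ℝ u y‖ₑ ^ p) ^ (q / p) :=
        ENNReal.tsum_le_tsum hlevel
    _ ≤ (4 * C : ℝ≥0∞) ^ q * (∑' j : ℤ, ∫⁻ y in S j, ‖fderiv ℝ u y‖ₑ ^ p) ^ (q / p) := by
        rw [ENNReal.tsum_mul_left]
        gcongr
        exact ENNReal.tsum_rpow_le_rpow_tsum _ hpq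
    _ ≤ _ := by
        rw [← lintegral_iUnion hS hSdisj, ENNReal.coe_rpow_of_nonneg _ hq0.le, ENNReal.coe_mul]
        gcongr
        · rfl
        · exact iUnion_subset fun j => inter_subset_inter_right _ inter_subset_left

theorem IsUniformWith.exists_lintegral_abs_sub_le {n : ℕ} {Ω : Set (Euc n)} {ε : ℝ} (hε : 0 < ε)
    (hε1 : ε ≤ 1) (hOpen : IsOpen Ω) (hΩ : IsUniformWith Ω ε) {p : ℝ} (hp : 1 ≤ p)
    (hpn : p < n) {q : ℝ} (hq : 1 / q = 1 / p - 1 / n) :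
    ∃ C : ℝ≥0, ∀ u : Euc n → ℝ, LocallyLipschitzOn Ω u → ∀ x ∈ Ω, ∀ r : ℝ, 0 < r →
      r < diam Ω → ∃ m : ℝ, ∫⁻ y in ball x r ∩ Ω, ENNReal.ofReal |u y - m| ^ q ≤
          C * (∫⁻ y in ball x ((1 + 2 / ε) * r) ∩ Ω, ‖fderiv ℝ u y‖ₑ ^ p) ^ (q / p) := by
  obtain ⟨C, hC⟩ := hΩ.exists_lintegral_pos_part_le hε hε1 hOpen hp hpn hq
  refine ⟨2 * C, fun u hu x hx r hr hrd => ?_⟩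
  have hD : MeasurableSet (ball x r ∩ Ω) := measurableSet_ball.inter hOpen.measurableSet
  have hDfin : volume (ball x r ∩ Ω) < ⊤ := measure_lt_top_mono inter_subset_left measure_ball_lt_top
  have huD : AEMeasurable u (volume.restrict (ball x r ∩ Ω)) :=
    (hu.continuousOn.mono inter_subset_right).aemeasurable hD
  have : IsFiniteMeasure (volume.restrict (ball x r ∩ Ω)) := ⟨by simpa using hDfin⟩
  obtain ⟨m, hm1, hm2⟩ := exists_median (volume.restrict (ball x r ∩ Ω)) huD
  simp only [Measure.restrict_apply' hD, inter_comm _ (ball x r ∩ Ω)] at hm1 hm2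
  refine ⟨m, ?_⟩
  have hpos := hC u hu x hx r hr hrd m hm1
  have hneg := hC (fun y => -u y) hu.neg x hx r hr hrd (-m) fun t ht => by
    refine le_trans (measure_mono ?_) ((hm2 (-t) (by linarith)).trans (measure_mono ?_)) <;>
    · refine inter_subset_inter_right _ fun y hy => ?_
      simp only [mem_ofPred_eq] at hy ⊢
      linarith
  simp only [fderiv_fun_neg, enorm_neg] at hneg
  have hmeas : AEMeasurable (fun y => ENNReal.ofReal (u y - m) ^ q)
      (volume.restrict (ball x r ∩ Ω)) := (huD.sub_const m).ennreal_ofReal.pow_const q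
  calc ∫⁻ y in ball x r ∩ Ω, ENNReal.ofReal |u y - m| ^ q
      ≤ ∫⁻ y in ball x r ∩ Ω,
          (ENNReal.ofReal (u y - m) ^ q + ENNReal.ofReal (-u y - -m) ^ q) := by
        refine lintegral_mono fun y => ?_
        rcases abs_cases (u y - m) with ⟨h, -⟩ | ⟨h, -⟩
        · rw [h]
          exact le_self_add
        · rw [h, neg_sub, neg_sub_neg]
          exact le_add_self
    _ ≤ _ := by
        rw [lintegral_add_left' hmeas, ENNReal.coe_mul, mul_assoc, ENNReal.coe_ofNat, two_mul]
        exact add_le_add hpos hneg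

/-- a bounded uniform domain is a local Sobolev–Poincaré imbedding
domain of order `p` for `1 ≤ p < n`. -/
theorem stmt0 (n : ℕ) (hn : 2 ≤ n) (p : ℝ) (hp1 : 1 ≤ p) (hpn : p < n)
    (Ω : Set (Euc n)) (hOpen : IsOpen Ω)
    (hConn : IsConnected Ω) (hBdd : Bornology.IsBounded Ω)
    (hUnif : IsUniformDomain Ω) :
    LocalSPLow n Ω p := by
  obtain ⟨ε, hε, hε1, hΩ⟩ := hUnif
  have hp0 : 0 < p := by linarith
  have hn0 : (0 : ℝ) < n := by linarith
  have hnp : (0 : ℝ) < n - p := by linarith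
  set q : ℝ := (n : ℝ) * p / ((n : ℝ) - p)
  have hq0 : 0 < q := by positivity
  have hq : 1 / q = 1 / p - 1 / n := by
    simp only [q]
    field_simp
  have hqinv : ((n : ℝ) - p) / (n * p) = 1 / q := by simp only [q, one_div_div]
  obtain ⟨C, hC⟩ := hΩ.exists_lintegral_abs_sub_le hε hε1 hOpen hp1 hpn hq
  refine ⟨max 1 ((C ^ (1 / q) : ℝ≥0) : ℝ), le_max_left _ _, 1 + 2 / ε,
    le_add_of_nonneg_right (by positivity), fun u hu x hx r hr hrd => ?_⟩
  obtain ⟨m, hm⟩ := hC u hu x hx r hr hrd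
  refine (iInf_le _ m).trans ?_
  rw [hqinv]
  simp only [ofReal_norm]
  refine (ENNReal.rpow_le_rpow hm (by positivity)).trans ?_
  rw [ENNReal.mul_rpow_of_nonneg _ _ (by positivity), ← ENNReal.rpow_mul,
    div_mul_div_cancel₀' hq0.ne', ← ENNReal.coe_rpow_of_nonneg _ (by positivity)]
  gcongr
  rw [← ENNReal.ofReal_coe_nnreal]
  exact ENNReal.ofReal_le_ofReal (le_max_right _ _)
end
end

section
/- Let n ≥ 2 and n < p < ∞, and let Ω ⊂ ℝⁿ be a bounded α-cigar domain with α = (p − n)/(p − 1). Then Ω is a local Sobolev–Poincaré imbedding domain of order p: there exist constants C ≥ 1 and λ ≥ 1 such that for every locally Lipschitz function u : Ω → ℝ, every x ∈ Ω, every 0 < r < diam(Ω) and all x₁, x₂ ∈ B(x,r) ∩ Ω, |u(x₁) − u(x₂)| ≤ C |x₁ − x₂|^{1 − n/p} (∫_{B(x,λr)∩Ω} |∇u(y)|^p dy)^{1/p}. -/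
open Set Metric MeasureTheory ENNReal NNReal

noncomputable section

namespace CigarMorrey

/-- Contracting a ball towards a point of its closure maps it into itself. -/
theorem add_smul_sub_mem_ball {n : ℕ} {z x y : Euc n} {ρ t : ℝ} (hx : x ∈ closedBall z ρ)
    (hy : y ∈ ball z ρ) (ht : 0 < t) (ht1 : t ≤ 1) : x + t • (y - x) ∈ ball z ρ := by
  rw [mem_closedBall, dist_eq_norm] at hx
  rw [mem_ball, dist_eq_norm] at hy ⊢
  have : x + t • (y - x) - z = (1 - t) • (x - z) + t • (y - z) := by module
  calc ‖x + t • (y - x) - z‖ ≤ ‖(1 - t) • (x - z)‖ + ‖t • (y - z)‖ := this ▸ norm_add_le _ _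
    _ = (1 - t) * ‖x - z‖ + t * ‖y - z‖ := by
      rw [norm_smul, norm_smul, Real.norm_of_nonneg (sub_nonneg.2 ht1), Real.norm_of_nonneg ht.le]
    _ < ρ := by nlinarith [mul_le_mul_of_nonneg_left hx (sub_nonneg.2 ht1),
        mul_lt_mul_of_pos_left hy ht]

theorem setLIntegral_ball_comp_contraction_le {n : ℕ} {z x : Euc n} {ρ t : ℝ}
    (hx : x ∈ closedBall z ρ) (ht : 0 < t) (ht1 : t ≤ 1) {H : Euc n → ℝ≥0∞} (hH : Measurable H) :
    ∫⁻ y in ball z ρ, H (x + t • (y - x)) ≤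
      ENNReal.ofReal (t ^ (-(n : ℝ))) * ∫⁻ y in ball z ρ, H y := by
  have hF : Measurable ((ball z ρ).indicator H) := hH.indicator measurableSet_ball
  calc ∫⁻ y in ball z ρ, H (x + t • (y - x))
      ≤ ∫⁻ y in ball z ρ, (ball z ρ).indicator H (x + t • (y - x)) := by
        refine setLIntegral_mono' measurableSet_ball fun y hy => ?_
        rw [indicator_of_mem (add_smul_sub_mem_ball hx hy ht ht1)]
    _ ≤ ∫⁻ y, (ball z ρ).indicator H (x + t • (y - x)) := setLIntegral_le_lintegral _ _
    _ = ∫⁻ y, (ball z ρ).indicator H ((x - t • x) + t • y) := by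
        congr with y; congr 1; module
    _ = ∫⁻ y, (ball z ρ).indicator H ((x - t • x) + y)
          ∂(Measure.map (fun y : Euc n => t • y) volume) := by
        rw [lintegral_map (f := fun y => (ball z ρ).indicator H ((x - t • x) + y))
          (hF.comp (measurable_const_add _)) (measurable_const_smul t)]
    _ = ENNReal.ofReal (t ^ (-(n : ℝ))) * ∫⁻ y in ball z ρ, H y := by
        rw [Measure.map_addHaar_smul _ ht.ne', lintegral_smul_measure,
          lintegral_add_left_eq_self, lintegral_indicator measurableSet_ball,
          finrank_euclideanSpace_fin, abs_of_pos (by positivity), Real.rpow_neg ht.le,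
          Real.rpow_natCast, smul_eq_mul]

theorem setLIntegral_ball_comp_contraction_le_rpow {n : ℕ} {p : ℝ} (hp : 1 < p) {z x : Euc n}
    {ρ t : ℝ} (hx : x ∈ closedBall z ρ) (ht : 0 < t) (ht1 : t ≤ 1) {G : Euc n → ℝ≥0∞}
    (hG : Measurable G) :
    ∫⁻ y in ball z ρ, G (x + t • (y - x)) ≤
      ENNReal.ofReal (t ^ (-(n / p) : ℝ)) *
        ((∫⁻ y in ball z ρ, G y ^ p) ^ (1 / p) * volume (ball z ρ) ^ (1 - 1 / p)) := by
  have hp0 : 0 < p := by linarith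
  have hpq := Real.HolderConjugate.conjExponent hp
  have hm : Measurable fun y : Euc n => G (x + t • (y - x)) :=
    hG.comp (by fun_prop)
  have h := ENNReal.lintegral_mul_le_Lp_mul_Lq (volume.restrict (ball z ρ)) hpq
    (f := fun y => G (x + t • (y - x))) (g := fun _ => 1) hm.aemeasurable aemeasurable_const
  have hq : 1 / Real.conjExponent p = 1 - 1 / p := by
    have := hpq.inv_add_inv_eq_one; rw [one_div, one_div]; linarith
  simp only [Pi.mul_apply, mul_one, ENNReal.one_rpow, lintegral_const, Measure.restrict_apply_univ,
    one_mul, hq] at h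
  refine h.trans ?_
  rw [← mul_assoc]
  gcongr
  calc (∫⁻ y in ball z ρ, G (x + t • (y - x)) ^ p) ^ (1 / p)
      ≤ (ENNReal.ofReal (t ^ (-(n : ℝ))) * ∫⁻ y in ball z ρ, G y ^ p) ^ (1 / p) := by
        gcongr
        exact setLIntegral_ball_comp_contraction_le hx ht ht1 (hG.pow_const p)
    _ = _ := by
        rw [ENNReal.mul_rpow_of_nonneg _ _ (by positivity),
          ENNReal.ofReal_rpow_of_pos (by positivity), ← Real.rpow_mul ht.le]
        congr 3; ring

theorem lintegral_Ioc_rpow_neg {a : ℝ} (ha : a < 1) :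
    ∫⁻ t in Ioc (0:ℝ) 1, ENNReal.ofReal (t ^ (-a)) = ENNReal.ofReal (1 / (1 - a)) := by
  have hi : IntervalIntegrable (fun t : ℝ => t ^ (-a)) volume 0 1 :=
    intervalIntegral.intervalIntegrable_rpow' (by linarith)
  rw [← ofReal_integral_eq_lintegral_ofReal ((intervalIntegrable_iff_integrableOn_Ioc_of_le
    zero_le_one).1 hi), ← intervalIntegral.integral_of_le zero_le_one,
    integral_rpow (Or.inl (by linarith))]
  · rw [Real.one_rpow, Real.zero_rpow (by linarith), sub_zero, neg_add_eq_sub]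
  · filter_upwards [ae_restrict_mem measurableSet_Ioc] with t ht
    exact Real.rpow_nonneg ht.1.le _

/-- A Lipschitz function on a convex set is controlled along segments by its gradient. -/
theorem ofReal_abs_sub_le_lintegral_segment {n : ℕ} {u : Euc n → ℝ} {s : Set (Euc n)} {K : ℝ≥0}
    (hs : Convex ℝ s) (hu : LipschitzOnWith K u s) {x y : Euc n} (hx : x ∈ s) (hy : y ∈ s)
    (hd : ∀ᵐ t ∂volume.restrict (Ioc (0:ℝ) 1), DifferentiableAt ℝ u (x + t • (y - x))) :
    ENNReal.ofReal |u y - u x| ≤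
      ENNReal.ofReal (dist x y) *
        ∫⁻ t in Ioc (0:ℝ) 1, ENNReal.ofReal ‖fderiv ℝ u (x + t • (y - x))‖ := by
  set φ : ℝ → ℝ := fun t => u (x + t • (y - x)) with hφ
  have hlip : LipschitzOnWith (K * ‖y - x‖₊) φ (uIcc 0 1) := by
    rw [uIcc_of_le zero_le_one]
    refine hu.comp (f := fun t : ℝ => x + t • (y - x)) (K := ‖y - x‖₊) ?_ ?_
    · refine (LipschitzWith.of_dist_le_mul fun a b => ?_).lipschitzOnWith
      rw [dist_add_left, dist_eq_norm, ← sub_smul, norm_smul, dist_eq_norm, mul_comm]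
      rfl
    · intro t ht
      exact hs.add_smul_sub_mem hx hy ht
  have hftc := hlip.absolutelyContinuousOnInterval.integral_deriv_eq_sub
  have h0 : φ 1 - φ 0 = u y - u x := by simp [hφ]
  rw [← h0, ← hftc, ← Real.norm_eq_abs, intervalIntegral.integral_of_le zero_le_one,
    ofReal_norm]
  refine (enorm_integral_le_lintegral_enorm _).trans ?_
  rw [← lintegral_const_mul' _ _ ENNReal.ofReal_ne_top]
  refine lintegral_mono_ae ?_
  filter_upwards [hd] with t ht
  have hder : HasDerivAt φ (fderiv ℝ u (x + t • (y - x)) (y - x)) t := by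
    refine ht.hasFDerivAt.comp_hasDerivAt t ?_
    simpa using ((hasDerivAt_id t).smul_const (y - x)).const_add x
  rw [hder.deriv, ← ofReal_norm, ← ENNReal.ofReal_mul dist_nonneg, dist_comm,
    dist_eq_norm, mul_comm]
  exact ENNReal.ofReal_le_ofReal (ContinuousLinearMap.le_opNorm _ _)

theorem setLIntegral_ball_abs_sub_le {n : ℕ} {p : ℝ} (hp1 : 1 < p) (hpn : (n : ℝ) < p)
    {u : Euc n → ℝ} {z x : Euc n} {ρ : ℝ} {K : ℝ≥0} (hu : LipschitzOnWith K u (closedBall z ρ))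
    (hx : x ∈ closedBall z ρ) :
    ∫⁻ y in ball z ρ, ENNReal.ofReal |u y - u x| ≤
      ENNReal.ofReal (2 * ρ / (1 - n / p)) *
        ((∫⁻ y in ball z ρ, ENNReal.ofReal ‖fderiv ℝ u y‖ ^ p) ^ (1 / p) *
          volume (ball z ρ) ^ (1 - 1 / p)) := by
  have hp0 : 0 < p := by linarith
  have hnp : (n : ℝ) / p < 1 := (div_lt_one hp0).2 hpn
  have hGm : Measurable fun y : Euc n => ENNReal.ofReal ‖fderiv ℝ u y‖ :=
    (measurable_fderiv ℝ u).norm.ennreal_ofReal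
  have hdiff : ∀ᵐ y : Euc n, y ∈ ball z ρ → DifferentiableAt ℝ u y := by
    filter_upwards [hu.ae_differentiableWithinAt_of_mem (μ := volume)] with y hy hyb
    exact (hy (ball_subset_closedBall hyb)).differentiableAt
      (Filter.mem_of_superset (isOpen_ball.mem_nhds hyb) ball_subset_closedBall)
  have hmap : Measurable fun q : Euc n × ℝ => x + q.2 • (q.1 - x) := by fun_prop
  have hND : MeasurableSet {y : Euc n | DifferentiableAt ℝ u y} :=
    measurableSet_of_differentiableAt ℝ u
  have hsegment : ∀ᵐ y ∂volume.restrict (ball z ρ), ∀ᵐ t ∂volume.restrict (Ioc (0:ℝ) 1),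
      DifferentiableAt ℝ u (x + t • (y - x)) := by
    rw [Measure.ae_ae_comm (p := fun y (t : ℝ) => DifferentiableAt ℝ u (x + t • (y - x)))
      (hmap hND)]
    filter_upwards [ae_restrict_mem measurableSet_Ioc] with t ht
    obtain ⟨F, hF⟩ : ∃ F : Euc n → ℝ≥0∞,
        F = {y : Euc n | ¬ DifferentiableAt ℝ u y}.indicator fun _ => 1 := ⟨_, rfl⟩
    have hFm : Measurable F := hF ▸ measurable_const.indicator hND.compl
    have h := setLIntegral_ball_comp_contraction_le hx ht.1 ht.2 hFm
    have h0 : ∫⁻ y in ball z ρ, F y = 0 := by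
      rw [lintegral_eq_zero_iff hFm, Filter.EventuallyEq, ae_restrict_iff' measurableSet_ball]
      filter_upwards [hdiff] with y hy hyb
      simp [hF, hy hyb]
    rw [h0, mul_zero, nonpos_iff_eq_zero, lintegral_eq_zero_iff
      (f := fun y => F (x + t • (y - x))) (hFm.comp (by fun_prop))] at h
    filter_upwards [h] with y hy
    by_contra hc
    simp [hF, hc] at hy
  have hjoint : Measurable fun q : Euc n × ℝ =>
      ENNReal.ofReal ‖fderiv ℝ u (x + q.2 • (q.1 - x))‖ := hGm.comp hmap
  set J := (∫⁻ y in ball z ρ, ENNReal.ofReal ‖fderiv ℝ u y‖ ^ p) ^ (1 / p) *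
          volume (ball z ρ) ^ (1 - 1 / p) with hJ
  calc ∫⁻ y in ball z ρ, ENNReal.ofReal |u y - u x|
      ≤ ∫⁻ y in ball z ρ, ENNReal.ofReal (2 * ρ) *
          ∫⁻ t in Ioc (0:ℝ) 1, ENNReal.ofReal ‖fderiv ℝ u (x + t • (y - x))‖ := by
        refine lintegral_mono_ae ?_
        filter_upwards [hsegment, ae_restrict_mem measurableSet_ball] with y hy hyb
        refine (ofReal_abs_sub_le_lintegral_segment (convex_closedBall z ρ) hu hx
          (ball_subset_closedBall hyb) hy).trans ?_
        gcongr
        linarith [dist_triangle_right x y z, mem_closedBall.1 hx, mem_ball.1 hyb]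
    _ = ENNReal.ofReal (2 * ρ) * ∫⁻ t in Ioc (0:ℝ) 1, ∫⁻ y in ball z ρ,
          ENNReal.ofReal ‖fderiv ℝ u (x + t • (y - x))‖ := by
        rw [lintegral_const_mul' _ _ ENNReal.ofReal_ne_top]
        rw [lintegral_lintegral_swap (f := fun y (t : ℝ) =>
          ENNReal.ofReal ‖fderiv ℝ u (x + t • (y - x))‖) hjoint.aemeasurable]
    _ ≤ ENNReal.ofReal (2 * ρ) * ∫⁻ t in Ioc (0:ℝ) 1,
          ENNReal.ofReal (t ^ (-(n / p) : ℝ)) * J := by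
        gcongr 1
        refine setLIntegral_mono' measurableSet_Ioc fun t ht => ?_
        exact setLIntegral_ball_comp_contraction_le_rpow hp1 hx ht.1 ht.2 hGm
    _ = ENNReal.ofReal (2 * ρ / (1 - n / p)) * J := by
        rw [lintegral_mul_const _ (by fun_prop), lintegral_Ioc_rpow_neg hnp, ← mul_assoc,
          ← ENNReal.ofReal_mul' (by have := sub_pos.2 hnp; positivity)]
        congr 2; ring

/-- Morrey's inequality on a ball, for the centre and another point of the closed ball. -/
theorem morrey_closedBall (n : ℕ) (hn : 2 ≤ n) {p : ℝ} (hpn : (n : ℝ) < p) :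
    ∃ M : ℝ, 0 ≤ M ∧ ∀ (Ω : Set (Euc n)) (u : Euc n → ℝ), LocallyLipschitzOnSet u Ω →
      ∀ (z w : Euc n) (ρ : ℝ), 0 < ρ → closedBall z ρ ⊆ Ω → w ∈ closedBall z ρ →
        ENNReal.ofReal |u z - u w| ≤ ENNReal.ofReal (M * ρ ^ (1 - (n : ℝ) / p)) *
          (∫⁻ y in ball z ρ, ENNReal.ofReal ‖fderiv ℝ u y‖ ^ p) ^ (1 / p) := by
  have hn' : (2 : ℝ) ≤ n := by exact_mod_cast hn
  have hp0 : 0 < p := by linarith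
  have hnp : 0 < 1 - (n : ℝ) / p := sub_pos.2 ((div_lt_one hp0).2 hpn)
  have : Nonempty (Fin n) := ⟨⟨0, by omega⟩⟩
  set v := volume (ball (0 : Euc n) 1) with hv
  have hv0 : v ≠ 0 := (measure_ball_pos volume _ one_pos).ne'
  have hvt : v ≠ ∞ := measure_ball_lt_top.ne
  refine ⟨4 / (1 - n / p) * v.toReal ^ (-(1 / p)), by positivity, ?_⟩
  intro Ω u hu z w ρ hρ hsub hw
  obtain ⟨K, hK⟩ := LocallyLipschitzOn.exists_lipschitzOnWith_of_compact
    (isCompact_closedBall z ρ) (LocallyLipschitzOn.mono (s := closedBall z ρ) (t := Ω)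
      (fun x hx => hu x hx) hsub)
  set I := (∫⁻ y in ball z ρ, ENNReal.ofReal ‖fderiv ℝ u y‖ ^ p) ^ (1 / p) with hI
  set V := volume (ball z ρ) with hV
  have hV0 : V ≠ 0 := (measure_ball_pos volume _ hρ).ne'
  have hVt : V ≠ ∞ := measure_ball_lt_top.ne
  have h1 := setLIntegral_ball_abs_sub_le (by linarith) hpn hK (mem_closedBall_self hρ.le)
  have h2 := setLIntegral_ball_abs_sub_le (by linarith) hpn hK hw
  have key : V * ENNReal.ofReal |u z - u w| ≤
      V * (ENNReal.ofReal (4 * ρ / (1 - n / p)) * (I * V ^ (-(1 / p)))) := by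
    calc V * ENNReal.ofReal |u z - u w| = ∫⁻ y in ball z ρ, ENNReal.ofReal |u z - u w| := by
          rw [setLIntegral_const, mul_comm]
      _ ≤ ∫⁻ y in ball z ρ, (ENNReal.ofReal |u y - u z| + ENNReal.ofReal |u y - u w|) := by
          refine lintegral_mono fun y => ?_
          rw [← ENNReal.ofReal_add (abs_nonneg _) (abs_nonneg _)]
          refine ENNReal.ofReal_le_ofReal ?_
          have := abs_sub_le (u z) (u y) (u w)
          rwa [abs_sub_comm (u z) (u y)] at this
      _ = (∫⁻ y in ball z ρ, ENNReal.ofReal |u y - u z|) +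
          ∫⁻ y in ball z ρ, ENNReal.ofReal |u y - u w| := by
          refine lintegral_add_left' ?_ _
          have hc : ContinuousOn (fun y => ENNReal.ofReal |u y - u z|) (ball z ρ) :=
            ENNReal.continuous_ofReal.comp_continuousOn
              ((hK.continuousOn.mono ball_subset_closedBall).sub continuousOn_const).abs
          exact hc.aemeasurable measurableSet_ball
      _ ≤ _ := add_le_add h1 h2
      _ = V * (ENNReal.ofReal (4 * ρ / (1 - n / p)) * (I * V ^ (-(1 / p)))) := by
          rw [← two_mul, ← hI, ← hV, sub_eq_add_neg 1 (1 / p), ENNReal.rpow_add _ _ hV0 hVt,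
            ENNReal.rpow_one,
            show (4 * ρ / (1 - n / p) : ℝ) = 2 * (2 * ρ / (1 - n / p)) by ring,
            ENNReal.ofReal_mul (p := 2) zero_le_two, ENNReal.ofReal_ofNat]
          ring
  rw [ENNReal.mul_le_mul_iff_right hV0 hVt] at key
  refine key.trans (le_of_eq ?_)
  have hVeq : V = ENNReal.ofReal (ρ ^ n * v.toReal) := by
    rw [hV, Measure.addHaar_ball volume z hρ.le, finrank_euclideanSpace_fin,
      ENNReal.ofReal_mul (by positivity), ENNReal.ofReal_toReal hvt]
  have hvpos : 0 < v.toReal := ENNReal.toReal_pos hv0 hvt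
  rw [hVeq, ENNReal.ofReal_rpow_of_pos (by positivity), mul_comm I, ← mul_assoc,
    ← ENNReal.ofReal_mul (by positivity), Real.mul_rpow (by positivity) hvpos.le,
    ← Real.rpow_natCast, ← Real.rpow_mul hρ.le, Real.rpow_sub hρ, Real.rpow_one,
    show (n : ℝ) * -(1 / p) = -(n / p) by ring, Real.rpow_neg hρ.le]
  congr 2
  field_simp

theorem ball_infDist_frontier_subset {n : ℕ} {Ω : Set (Euc n)} (hΩ : Ω ≠ univ) {z : Euc n}
    (hz : z ∈ Ω) : ball z (infDist z (frontier Ω)) ⊆ Ω := by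
  obtain ⟨y, hy, hzy⟩ := exists_mem_frontier_infDist_compl_eq_dist hz hΩ
  intro w hw
  by_contra hc
  have h1 : infDist z Ωᶜ ≤ dist z w := infDist_le_dist_of_mem hc
  have h2 : infDist z (frontier Ω) ≤ dist z y := infDist_le_dist_of_mem hy
  rw [mem_ball, dist_comm] at hw
  linarith

theorem infDist_frontier_pos {n : ℕ} {Ω : Set (Euc n)} (hO : IsOpen Ω) (hΩ : Ω ≠ univ)
    {z : Euc n} (hz : z ∈ Ω) : 0 < infDist z (frontier Ω) := by
  obtain ⟨y, hy, -⟩ := exists_mem_frontier_infDist_compl_eq_dist hz hΩ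
  refine (isClosed_frontier.notMem_iff_infDist_pos ⟨y, hy⟩).1 fun h => ?_
  rw [hO.frontier_eq] at h
  exact h.2 hz

theorem dist_le_of_arclengthOn {n : ℕ} {γ : ℝ → Euc n} {L s t : ℝ} (h : ArclengthOn γ L)
    (hs : 0 ≤ s) (hst : s ≤ t) (ht : t ≤ L) : dist (γ s) (γ t) ≤ t - s := by
  have h1 := eVariationOn.edist_le γ (s := Icc s t) (left_mem_Icc.2 hst) (right_mem_Icc.2 hst)
  rw [h s t hs hst ht, edist_dist] at h1
  exact (ENNReal.ofReal_le_ofReal_iff (by linarith)).1 h1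

theorem lipschitzOnWith_one_of_dist_le {X : Type*} [PseudoMetricSpace X] {γ : ℝ → X} {L : ℝ}
    (hγ : ∀ s t, 0 ≤ s → s ≤ t → t ≤ L → dist (γ s) (γ t) ≤ t - s) :
    LipschitzOnWith 1 γ (Icc 0 L) := by
  refine LipschitzOnWith.of_dist_le_mul fun s hs t ht => ?_
  rw [NNReal.coe_one, one_mul, Real.dist_eq]
  rcases le_total s t with h | h
  · rw [abs_sub_comm]
    exact (hγ s t hs.1 h ht.2).trans (le_abs_self _)
  · rw [dist_comm]
    exact (hγ t s ht.1 h hs.2).trans (le_abs_self _)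

/-- Following a curve by last exits from balls of radius `ρ` about its points reaches the
endpoint in finitely many steps, and the centres visited before the end are separated. -/
theorem exists_separated_chain {X : Type*} [PseudoMetricSpace X] {γ : ℝ → X} {L δ : ℝ}
    {ρ : X → ℝ} (hL : 0 ≤ L)
    (hγ : ∀ s t, 0 ≤ s → s ≤ t → t ≤ L → dist (γ s) (γ t) ≤ t - s) (hδ : 0 < δ)
    (hρ : ∀ t ∈ Icc 0 L, δ ≤ ρ (γ t)) :
    ∃ (K : ℕ) (t : ℕ → ℝ), t 0 = 0 ∧ t K = L ∧ Monotone t ∧ (∀ i, t i ∈ Icc 0 L) ∧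
      (∀ i, dist (γ (t i)) (γ (t (i + 1))) ≤ ρ (γ (t i))) ∧
      ∀ i j, i < j → j < K → ρ (γ (t i)) ≤ dist (γ (t i)) (γ (t j)) := by
  have hcont := (lipschitzOnWith_one_of_dist_le hγ).continuousOn
  have hex : ∀ t : ℝ, ∃ s, t ∈ Icc 0 L →
      IsGreatest {s ∈ Icc 0 L | dist (γ t) (γ s) ≤ ρ (γ t)} s := by
    intro t
    by_cases ht : t ∈ Icc 0 L
    · have hcl : IsClosed {s ∈ Icc 0 L | dist (γ t) (γ s) ≤ ρ (γ t)} :=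
        ContinuousOn.preimage_isClosed_of_isClosed (t := Iic (ρ (γ t)))
          (continuous_const.dist continuous_id |>.comp_continuousOn hcont) isClosed_Icc isClosed_Iic
      have hcpt := isCompact_Icc.of_isClosed_subset hcl (sep_subset _ _)
      obtain ⟨s, hs⟩ := hcpt.exists_isGreatest
        ⟨t, ht, by rw [dist_self]; exact hδ.le.trans (hρ t ht)⟩
      exact ⟨s, fun _ => hs⟩
    · exact ⟨0, fun h => absurd h ht⟩
  choose τ hτ using hex
  have hle : ∀ t ∈ Icc 0 L, t ≤ τ t := fun t ht =>
    (hτ t ht).2 ⟨ht, by rw [dist_self]; exact hδ.le.trans (hρ t ht)⟩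
  have hsep : ∀ t ∈ Icc 0 L, τ t < L → ∀ s ∈ Icc 0 L, τ t ≤ s → ρ (γ t) ≤ dist (γ t) (γ s) := by
    intro t ht htL s hs hts
    by_contra! hc
    have hmem := (hτ t ht).2 ⟨hs, hc.le⟩
    obtain rfl : s = τ t := le_antisymm hmem hts
    set s' := min L (τ t + (ρ (γ t) - dist (γ t) (γ (τ t)))) with hs'
    have h1 : τ t < s' := lt_min htL (by linarith)
    have h2 : s' ≤ L := min_le_left _ _
    have h3 : s' ≤ τ t + (ρ (γ t) - dist (γ t) (γ (τ t))) := min_le_right _ _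
    have h4 := hγ (τ t) s' hs.1 h1.le h2
    have h5 : s' ≤ τ t := (hτ t ht).2 ⟨⟨hs.1.trans h1.le, h2⟩,
      (dist_triangle _ (γ (τ t)) _).trans (by linarith)⟩
    linarith
  set t : ℕ → ℝ := fun i => τ^[i] 0 with ht
  have hsucc : ∀ i, t (i + 1) = τ (t i) := fun i => Function.iterate_succ_apply' τ i 0
  have hmem : ∀ i, t i ∈ Icc 0 L := by
    intro i
    induction i with
    | zero => exact ⟨le_rfl, hL⟩
    | succ i ih => rw [hsucc]; exact (hτ _ ih).1.1
  have hmono : Monotone t := monotone_nat_of_le_succ fun i => by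
    rw [hsucc]; exact hle _ (hmem i)
  have hend : ∃ K, t K = L := by
    by_contra! hc
    have hlt : ∀ i, t i < L := fun i => lt_of_le_of_ne (hmem i).2 (hc i)
    have hgrow : ∀ i : ℕ, i * δ ≤ t i := by
      intro i
      induction i with
      | zero => simp [ht]
      | succ i ih =>
        have h1 := hsep _ (hmem i) (hsucc i ▸ hlt (i + 1)) _ (hmem (i + 1)) (hsucc i).ge
        have h2 := hγ _ _ (hmem i).1 (hmono i.le_succ) (hmem (i + 1)).2
        have h3 := hρ _ (hmem i)
        push_cast
        linarith
    obtain ⟨N, hN⟩ := exists_nat_gt (L / δ)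
    rw [div_lt_iff₀ hδ] at hN
    linarith [hgrow N, hlt N]
  classical
  refine ⟨Nat.find hend, t, rfl, Nat.find_spec hend, hmono, hmem, fun i => ?_, ?_⟩
  · rw [hsucc]
    exact (hτ _ (hmem i)).1.2
  · intro i j hij hj
    refine hsep _ (hmem i) ?_ _ (hmem j) (hsucc i ▸ hmono hij)
    rw [← hsucc]
    exact lt_of_le_of_ne (hmem _).2 (Nat.find_min hend (lt_of_le_of_lt hij hj))

theorem sum_setLIntegral_Ioc_le {t : ℕ → ℝ} (ht : Monotone t) (f : ℝ → ℝ≥0∞) (m : ℕ) :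
    ∑ i ∈ Finset.range m, ∫⁻ s in Ioc (t i) (t (i + 1)), f s ≤ ∫⁻ s in Ioc (t 0) (t m), f s := by
  induction m with
  | zero => simp
  | succ m ih =>
    rw [Finset.sum_range_succ, ← Ioc_union_Ioc_eq_Ioc (ht m.zero_le) (ht m.le_succ),
      lintegral_union measurableSet_Ioc (Ioc_disjoint_Ioc_of_le le_rfl)]
    gcongr

theorem rpow_div_four_le {α d e : ℝ} (hα0 : 0 < α) (hα1 : α < 1) (he : 0 < e) (hed : e ≤ 2 * d) :
    d ^ α / 4 ≤ d / 2 * e ^ (α - 1) := by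
  have hd : 0 < d := by linarith
  have h1 : (2 * d) ^ (α - 1) ≤ e ^ (α - 1) :=
    Real.rpow_le_rpow_of_nonpos he hed (by linarith)
  have h2 : (2 : ℝ) ^ (-1 : ℝ) ≤ 2 ^ (α - 1) :=
    Real.rpow_le_rpow_of_exponent_le one_le_two (by linarith)
  rw [Real.rpow_neg_one] at h2
  rw [Real.mul_rpow zero_le_two hd.le] at h1
  have h3 : d ^ α = d * d ^ (α - 1) := by
    rw [← Real.rpow_one_add' hd.le (by linarith)]; congr 1; ring
  have h4 : 0 < d ^ (α - 1) := Real.rpow_pos_of_pos hd _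
  rw [h3]
  have h5 : 2⁻¹ * d ^ (α - 1) ≤ e ^ (α - 1) :=
    (mul_le_mul_of_nonneg_right h2 h4.le).trans h1
  nlinarith [mul_le_mul_of_nonneg_left h5 hd.le]

/-- In a cigar domain, two points that are far apart relative to the boundary distance of the
second are joined by a chain of separated Whitney type balls with controlled radii. -/
theorem exists_whitney_chain {n : ℕ} {Ω : Set (Euc n)} (hO : IsOpen Ω) (hΩ : Ω ≠ univ)
    {α C L : ℝ} (hα0 : 0 < α) (hα1 : α < 1) (hC : 0 ≤ C) (hL : 0 ≤ L) {γ : ℝ → Euc n}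
    (hne : γ 0 ≠ γ L) (hmaps : MapsTo γ (Icc 0 L) Ω) (harc : ArclengthOn γ L)
    (hcigar : (∫⁻ t in Icc (0:ℝ) L, ENNReal.ofReal (infDist (γ t) (frontier Ω) ^ (α - 1)))
      ≤ ENNReal.ofReal (C * dist (γ 0) (γ L) ^ α))
    (hfar : infDist (γ L) (frontier Ω) ≤ 2 * dist (γ 0) (γ L)) :
    ∃ (m : ℕ) (z : ℕ → Euc n), z 0 = γ 0 ∧ z m = γ L ∧ (∀ i, z i ∈ Ω) ∧
      (∀ i, dist (z i) (z (i + 1)) ≤ infDist (z i) (frontier Ω) / 2) ∧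
      (∀ i j, i < j → j < m → infDist (z i) (frontier Ω) / 2 ≤ dist (z i) (z j)) ∧
      ∑ i ∈ Finset.range m, infDist (z i) (frontier Ω) ^ α ≤
        (4 * C + 4) * dist (γ 0) (γ L) ^ α := by
  set d : Euc n → ℝ := fun z => infDist z (frontier Ω) with hd
  have hdpos : ∀ z ∈ Ω, 0 < d z := fun z hz => infDist_frontier_pos hO hΩ hz
  have hdlip : ∀ z w, d z ≤ d w + dist z w := fun z w => infDist_le_infDist_add_dist
  have hγ : ∀ s t, 0 ≤ s → s ≤ t → t ≤ L → dist (γ s) (γ t) ≤ t - s :=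
    fun s t h1 h2 h3 => dist_le_of_arclengthOn harc h1 h2 h3
  have hcont := (lipschitzOnWith_one_of_dist_le hγ).continuousOn
  obtain ⟨t₀, ht₀, hmin⟩ := isCompact_Icc.exists_isMinOn (nonempty_Icc.2 hL)
    ((continuous_infDist_pt (frontier Ω)).comp_continuousOn hcont)
  obtain ⟨K, t, ht0, htK, hmono, hmem, hstep, hsep⟩ := exists_separated_chain
    (ρ := fun z => d z / 2) hL hγ (half_pos (hdpos _ (hmaps ht₀)))
    fun t ht => div_le_div_of_nonneg_right (hmin ht) zero_le_two
  obtain ⟨m, rfl⟩ : ∃ m, K = m + 1 := by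
    refine Nat.exists_eq_succ_of_ne_zero ?_
    rintro rfl
    exact hne (by rw [← htK, ht0])
  refine ⟨m + 1, fun i => γ (t i), by simp only [ht0], by simp only [htK],
    fun i => hmaps (hmem i), hstep, hsep, ?_⟩
  set D := dist (γ 0) (γ L) with hD
  have hDα : 0 ≤ D ^ α := Real.rpow_nonneg dist_nonneg _
  have hfirst : ∑ i ∈ Finset.range m, d (γ (t i)) ^ α ≤ 4 * C * D ^ α := by
    have hpiece : ∀ i ∈ Finset.range m, ENNReal.ofReal (d (γ (t i)) ^ α / 4) ≤
        ∫⁻ s in Ioc (t i) (t (i + 1)), ENNReal.ofReal (d (γ s) ^ (α - 1)) := by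
      intro i hi
      have hgap : t i + d (γ (t i)) / 2 ≤ t (i + 1) := by
        have h1 := hsep i (i + 1) i.lt_succ_self (by simpa using hi)
        have h2 := hγ _ _ (hmem i).1 (hmono i.le_succ) (hmem (i + 1)).2
        linarith
      calc ENNReal.ofReal (d (γ (t i)) ^ α / 4)
          = ∫⁻ s in Ioc (t i) (t i + d (γ (t i)) / 2),
              ENNReal.ofReal (d (γ (t i)) ^ α / 4 / (d (γ (t i)) / 2)) := by
            have := hdpos _ (hmaps (hmem i))
            rw [setLIntegral_const, Real.volume_Ioc, ← ENNReal.ofReal_mul (by positivity)]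
            congr 1
            field_simp
            ring
        _ ≤ ∫⁻ s in Ioc (t i) (t i + d (γ (t i)) / 2), ENNReal.ofReal (d (γ s) ^ (α - 1)) := by
            refine setLIntegral_mono' measurableSet_Ioc fun s hs => ENNReal.ofReal_le_ofReal ?_
            have hsL : s ≤ L := hs.2.trans (hgap.trans (hmem _).2)
            have hs0 : s ∈ Icc 0 L := ⟨(hmem i).1.trans hs.1.le, hsL⟩
            have h1 := hdpos _ (hmaps (hmem i))
            have h2 := hdlip (γ s) (γ (t i))
            have h3 := hγ _ _ (hmem i).1 hs.1.le hsL
            rw [dist_comm] at h3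
            rw [div_le_iff₀ (by positivity), mul_comm]
            exact rpow_div_four_le hα0 hα1 (hdpos _ (hmaps hs0)) (by linarith [hs.2])
        _ ≤ _ := lintegral_mono_set (Ioc_subset_Ioc_right hgap)
    have hsum : ENNReal.ofReal (∑ i ∈ Finset.range m, d (γ (t i)) ^ α / 4) ≤
        ENNReal.ofReal (C * D ^ α) := by
      rw [ENNReal.ofReal_sum_of_nonneg fun i _ =>
        div_nonneg (Real.rpow_nonneg infDist_nonneg _) zero_le_four]
      refine (Finset.sum_le_sum hpiece).trans ((sum_setLIntegral_Ioc_le hmono _ m).trans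
        (le_trans (lintegral_mono_set ?_) hcigar))
      exact Ioc_subset_Icc_self.trans (Icc_subset_Icc ht0.ge (hmem m).2)
    rw [ENNReal.ofReal_le_ofReal_iff (by positivity), ← Finset.sum_div] at hsum
    linarith
  have hlast : d (γ (t m)) ^ α ≤ 4 * D ^ α := by
    have h1 := hdlip (γ (t m)) (γ (t (m + 1)))
    have h2 := hstep m
    rw [htK] at h1 h2
    calc d (γ (t m)) ^ α ≤ (4 * D) ^ α :=
          Real.rpow_le_rpow infDist_nonneg (by linarith) hα0.le
      _ = 4 ^ α * D ^ α := Real.mul_rpow zero_le_four dist_nonneg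
      _ ≤ 4 * D ^ α := by
          gcongr
          exact (Real.rpow_le_rpow_of_exponent_le (by norm_num) hα1.le).trans_eq (Real.rpow_one 4)
  rw [Finset.sum_range_succ]
  linarith

/-- A volume bound for the number of separated points in a ball. -/
theorem card_le_of_separated {n : ℕ} (hn : n ≠ 0) {D : ℝ} (hD : 0 < D) (S : Finset ℕ)
    (z : ℕ → Euc n) (y : Euc n) (hy : ∀ i ∈ S, dist (z i) y ≤ D)
    (hz : ∀ i ∈ S, ∀ j ∈ S, i < j → D / 3 ≤ dist (z i) (z j)) :
    S.card ≤ 12 ^ n := by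
  have : Nonempty (Fin n) := ⟨⟨0, by omega⟩⟩
  have hdisj : (S : Set ℕ).PairwiseDisjoint fun i => ball (z i) (D / 6) := by
    intro i hi j hj hij
    refine ball_disjoint_ball ?_
    rcases lt_or_gt_of_ne hij with h | h
    · linarith [hz i hi j hj h]
    · rw [dist_comm]
      linarith [hz j hj i hi h]
  have hsub : (⋃ i ∈ S, ball (z i) (D / 6)) ⊆ ball y (2 * D) := by
    refine iUnion₂_subset fun i hi => ball_subset_ball' ?_
    linarith [hy i hi]
  have hvol := measure_mono (μ := volume) hsub
  rw [measure_biUnion_finset hdisj fun _ _ => measurableSet_ball] at hvol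
  simp only [Measure.addHaar_ball volume _ (show 0 ≤ D / 6 by positivity),
    Measure.addHaar_ball volume _ (show 0 ≤ 2 * D by positivity), Finset.sum_const,
    nsmul_eq_mul, finrank_euclideanSpace_fin, ← mul_assoc] at hvol
  rw [ENNReal.mul_le_mul_iff_left (measure_ball_pos volume _ one_pos).ne'
    measure_ball_lt_top.ne, ← ENNReal.ofReal_natCast, ← ENNReal.ofReal_mul (by positivity),
    ENNReal.ofReal_le_ofReal_iff (by positivity),
    show 2 * D = 12 * (D / 6) by ring, mul_pow 12] at hvol
  exact_mod_cast le_of_mul_le_mul_right hvol (by positivity)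

theorem sum_setLIntegral_ball_le {n : ℕ} (hn : n ≠ 0) {F : Set (Euc n)} (m : ℕ) (z : ℕ → Euc n)
    (hpos : ∀ i, 0 < infDist (z i) F)
    (hsep : ∀ i j, i < j → j < m → infDist (z i) F / 2 ≤ dist (z i) (z j)) {U : Set (Euc n)}
    (hU : ∀ i < m, ball (z i) (infDist (z i) F / 2) ⊆ U) {f : Euc n → ℝ≥0∞} (hf : Measurable f) :
    ∑ i ∈ Finset.range m, ∫⁻ y in ball (z i) (infDist (z i) F / 2), f y ≤
      12 ^ n * ∫⁻ y in U, f y := by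
  classical
  calc ∑ i ∈ Finset.range m, ∫⁻ y in ball (z i) (infDist (z i) F / 2), f y
      = ∑ i ∈ Finset.range m, ∫⁻ y in U, (ball (z i) (infDist (z i) F / 2)).indicator f y := by
        refine Finset.sum_congr rfl fun i hi => ?_
        rw [setLIntegral_indicator measurableSet_ball,
          inter_eq_self_of_subset_left (hU i (Finset.mem_range.1 hi))]
    _ = ∫⁻ y in U, ∑ i ∈ Finset.range m, (ball (z i) (infDist (z i) F / 2)).indicator f y :=
        (lintegral_finsetSum _ fun i _ => hf.indicator measurableSet_ball).symm
    _ ≤ ∫⁻ y in U, 12 ^ n * f y := by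
        refine lintegral_mono fun y => ?_
        set S := (Finset.range m).filter fun i => y ∈ ball (z i) (infDist (z i) F / 2) with hS
        have hsum : ∑ i ∈ Finset.range m, (ball (z i) (infDist (z i) F / 2)).indicator f y =
            S.card * f y := by
          simp only [indicator_apply, ← Finset.sum_filter, Finset.sum_const, nsmul_eq_mul, hS]
        rw [hsum]
        gcongr
        rcases S.eq_empty_or_nonempty with h | ⟨k, hk⟩
        · simp [h]
        have hmem : ∀ i ∈ S, i < m ∧ dist y (z i) < infDist (z i) F / 2 := fun i hi => by
          simpa [hS] using hi
        have h1 : ∀ i, infDist (z i) F ≤ infDist y F + dist y (z i) := fun i => by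
          rw [dist_comm]; exact infDist_le_infDist_add_dist
        have h2 : ∀ i, infDist y F ≤ infDist (z i) F + dist y (z i) :=
          fun i => infDist_le_infDist_add_dist
        exact_mod_cast card_le_of_separated hn (D := infDist y F)
          (by linarith [h1 k, hpos k, (hmem k hk).2]) S z y
          (fun i hi => by rw [dist_comm]; linarith [h1 i, (hmem i hi).2])
          (fun i hi j hj hij => by
            linarith [h2 i, (hmem i hi).2, hsep i j hij (hmem j hj).1])
    _ = 12 ^ n * ∫⁻ y in U, f y := lintegral_const_mul _ hf

theorem sum_le_of_sum_rpow_le {ι : Type*} {s : Finset ι} {d : ι → ℝ} {α R : ℝ} (hα0 : 0 < α)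
    (hα1 : α ≤ 1) (hd : ∀ i ∈ s, 0 ≤ d i) (hR : 0 ≤ R) (h : ∑ i ∈ s, d i ^ α ≤ R ^ α) :
    ∑ i ∈ s, d i ≤ R := by
  have hle : ∀ i ∈ s, d i ≤ R := fun i hi => by
    refine (Real.rpow_le_rpow_iff (hd i hi) hR hα0).1 (le_trans ?_ h)
    exact Finset.single_le_sum (f := fun i => d i ^ α)
      (fun j hj => Real.rpow_nonneg (hd j hj) _) hi
  have hsplit : ∀ x : ℝ, 0 ≤ x → x ^ α * x ^ (1 - α) = x := fun x hx => by
    rw [← Real.rpow_add_of_nonneg hx hα0.le (by linarith), add_sub_cancel, Real.rpow_one]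
  calc ∑ i ∈ s, d i ≤ ∑ i ∈ s, d i ^ α * R ^ (1 - α) := by
        refine Finset.sum_le_sum fun i hi => ?_
        conv_lhs => rw [← hsplit _ (hd i hi)]
        exact mul_le_mul_of_nonneg_left (Real.rpow_le_rpow (hd i hi) (hle i hi) (by linarith))
          (Real.rpow_nonneg (hd i hi) _)
    _ = (∑ i ∈ s, d i ^ α) * R ^ (1 - α) := (Finset.sum_mul _ _ _).symm
    _ ≤ R ^ α * R ^ (1 - α) := mul_le_mul_of_nonneg_right h (Real.rpow_nonneg hR _)
    _ = R := hsplit R hR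

/-- Hölder's inequality turns Morrey estimates on a chain of balls into a global one. -/
theorem sum_holder_le {n : ℕ} {p A R N : ℝ} (hp : 1 < p) (hpn : (n : ℝ) < p)
    (hA : 0 ≤ A) (hR : 0 ≤ R) (hN : 0 ≤ N) {s : Finset ℕ} {d : ℕ → ℝ} {I : ℕ → ℝ≥0∞} {J : ℝ≥0∞}
    (hd : ∀ i ∈ s, 0 ≤ d i)
    (hsum : ∑ i ∈ s, d i ^ ((p - n) / (p - 1)) ≤ A * R ^ ((p - n) / (p - 1)))
    (hI : ∑ i ∈ s, I i ≤ ENNReal.ofReal N * J) :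
    ∑ i ∈ s, ENNReal.ofReal (d i ^ (1 - (n : ℝ) / p)) * I i ^ (1 / p) ≤
      ENNReal.ofReal (A ^ ((p - 1) / p) * N ^ (1 / p) * R ^ (1 - (n : ℝ) / p)) * J ^ (1 / p) := by
  have hp0 : 0 < p := by linarith
  have hp1 : 0 < p - 1 := by linarith
  have hpq := (Real.HolderConjugate.conjExponent hp).symm
  have hq : p.conjExponent = p / (p - 1) := rfl
  have hnp : 0 < 1 - (n : ℝ) / p := sub_pos.2 ((div_lt_one hp0).2 hpn)
  refine (ENNReal.inner_le_Lp_mul_Lq s _ _ hpq).trans ?_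
  have h1 : ∑ i ∈ s, ENNReal.ofReal (d i ^ (1 - (n : ℝ) / p)) ^ p.conjExponent ≤
      ENNReal.ofReal (A * R ^ ((p - n) / (p - 1))) := by
    refine le_trans (le_of_eq ?_) (ENNReal.ofReal_le_ofReal hsum)
    rw [ENNReal.ofReal_sum_of_nonneg fun i hi => Real.rpow_nonneg (hd i hi) _]
    refine Finset.sum_congr rfl fun i hi => ?_
    rw [ENNReal.ofReal_rpow_of_nonneg (Real.rpow_nonneg (hd i hi) _) hpq.nonneg,
      ← Real.rpow_mul (hd i hi), hq]
    congr 2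
    field_simp
  have h2 : ∑ i ∈ s, (I i ^ (1 / p)) ^ p ≤ ENNReal.ofReal N * J := by
    refine le_trans (le_of_eq (Finset.sum_congr rfl fun i _ => ?_)) hI
    rw [← ENNReal.rpow_mul, one_div_mul_cancel hp0.ne', ENNReal.rpow_one]
  calc _ ≤ ENNReal.ofReal (A * R ^ ((p - n) / (p - 1))) ^ (1 / p.conjExponent) *
        (ENNReal.ofReal N * J) ^ (1 / p) := by
        have := hpq.pos
        gcongr
    _ = _ := by
        rw [ENNReal.mul_rpow_of_nonneg _ _ (by positivity), hq, one_div_div,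
          ENNReal.ofReal_rpow_of_nonneg (by positivity) (by positivity),
          ENNReal.ofReal_rpow_of_nonneg hN (by positivity), ← mul_assoc,
          ← ENNReal.ofReal_mul (by positivity), Real.mul_rpow hA (by positivity),
          ← Real.rpow_mul hR,
          show (p - n) / (p - 1) * ((p - 1) / p) = 1 - n / p by field_simp]
        congr 2
        ring

end CigarMorrey

open CigarMorrey

/-- a bounded `(p-n)/(p-1)`-cigar domain is a local
Sobolev–Poincaré imbedding domain of order `p`, `n < p < ∞`. -/
theorem stmt5 (n : ℕ) (hn : 2 ≤ n) (p : ℝ) (hpn : (n : ℝ) < p)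
    (Ω : Set (Euc n)) (hOpen : IsOpen Ω)
    (hConn : IsConnected Ω) (hBdd : Bornology.IsBounded Ω)
    (hCigar : IsCigarDomain Ω ((p - n) / (p - 1))) :
    LocalSPHigh n Ω p := by
  have hn' : (2 : ℝ) ≤ n := by exact_mod_cast hn
  have hp1 : 0 < p - 1 := by linarith
  have hp0 : 0 < p := by linarith
  have : Nonempty (Fin n) := ⟨⟨0, by omega⟩⟩
  have hΩ : Ω ≠ univ := by
    rintro rfl
    exact NormedSpace.unbounded_univ ℝ (Euc n) hBdd
  obtain ⟨C, hC, hcig⟩ := hCigar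
  set α := (p - n) / (p - 1) with hα
  have hα0 : 0 < α := div_pos (by linarith) hp1
  have hα1 : α < 1 := (div_lt_one hp1).2 (by linarith)
  obtain ⟨M, hM, hmorrey⟩ := morrey_closedBall n hn hpn
  have hnp : 0 < 1 - (n : ℝ) / p := sub_pos.2 ((div_lt_one hp0).2 hpn)
  set A := 4 * C + 4 with hA
  have hA0 : 0 < A := by positivity
  set B := A ^ ((p - 1) / p) * ((12 : ℝ) ^ n) ^ (1 / p) with hB
  have hB0 : 0 ≤ B := by positivity
  have hAα : 0 ≤ A ^ α⁻¹ := by positivity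
  refine ⟨1 + M + M * B, by nlinarith [mul_nonneg hM hB0], 2 * A ^ α⁻¹ + 3, by linarith, ?_⟩
  intro u hu x hx r hr hrd x₁ hx₁ x₂ hx₂
  set δ := dist x₁ x₂ with hδ
  have hx₁x := mem_ball.1 hx₁.1
  have hx₂x := mem_ball.1 hx₂.1
  have hδr : δ ≤ 2 * r := by linarith [dist_triangle_right x₁ x₂ x]
  have hAr : 0 ≤ A ^ α⁻¹ * r := by positivity
  rcases eq_or_ne x₁ x₂ with rfl | hne
  · simp
  have hδ0 : 0 < δ := dist_pos.2 hne
  have hδe : 0 ≤ δ ^ (1 - (n : ℝ) / p) := Real.rpow_nonneg hδ0.le _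
  have hball : ∀ z ∈ Ω, closedBall z (infDist z (frontier Ω) / 2) ⊆ Ω := fun z hz =>
    (closedBall_subset_ball (half_lt_self (infDist_frontier_pos hOpen hΩ hz))).trans
      (ball_infDist_frontier_subset hΩ hz)
  rcases le_or_gt δ (infDist x₂ (frontier Ω) / 2) with hnear | hfar
  · have h := hmorrey Ω u hu x₂ x₁ δ hδ0
      ((closedBall_subset_closedBall hnear).trans (hball x₂ hx₂.2)) (mem_closedBall.2 le_rfl)
    rw [abs_sub_comm]
    refine h.trans ?_
    gcongr
    · nlinarith [mul_nonneg hM hB0]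
    · refine subset_inter (ball_subset_ball' ?_) (ball_subset_closedBall.trans
        ((closedBall_subset_closedBall hnear).trans (hball x₂ hx₂.2)))
      linarith
  · obtain ⟨L, hL, γ, rfl, rfl, hmaps, harc, hint⟩ := hcig x₁ hx₁.2 x₂ hx₂.2
    obtain ⟨m, z, hz0, hzm, hzΩ, hstep, hsep, hsum⟩ := exists_whitney_chain hOpen hΩ hα0 hα1
      hC.le hL hne hmaps harc hint (by linarith)
    have hdpos : ∀ i, 0 < infDist (z i) (frontier Ω) := fun i =>
      infDist_frontier_pos hOpen hΩ (hzΩ i)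
    have hlen : ∑ i ∈ Finset.range m, infDist (z i) (frontier Ω) ≤ A ^ α⁻¹ * δ := by
      refine sum_le_of_sum_rpow_le hα0 hα1.le (fun i _ => (hdpos i).le) (by positivity) ?_
      rwa [Real.mul_rpow hAα hδ0.le, ← Real.rpow_mul hA0.le, inv_mul_cancel₀ hα0.ne',
        Real.rpow_one]
    have hU : ∀ i < m, ball (z i) (infDist (z i) (frontier Ω) / 2) ⊆
        ball x ((2 * A ^ α⁻¹ + 3) * r) ∩ Ω := by
      intro i hi
      refine subset_inter (ball_subset_ball' ?_) (ball_subset_closedBall.trans (hball _ (hzΩ i)))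
      have h1 : dist (z 0) (z i) ≤ ∑ j ∈ Finset.range i, infDist (z j) (frontier Ω) :=
        dist_le_range_sum_of_dist_le i fun {k} _ => (hstep k).trans (half_le_self (hdpos k).le)
      have h2 : ∑ j ∈ Finset.range (i + 1), infDist (z j) (frontier Ω) ≤
          ∑ j ∈ Finset.range m, infDist (z j) (frontier Ω) :=
        Finset.sum_le_sum_of_subset_of_nonneg (Finset.range_subset_range.2 hi)
          fun j _ _ => (hdpos j).le
      rw [Finset.sum_range_succ] at h2
      rw [hz0, dist_comm] at h1
      have h3 := mul_le_mul_of_nonneg_left hδr hAα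
      linarith [dist_triangle (z i) (γ 0) x, hdpos i]
    set J := ∫⁻ y in ball x ((2 * A ^ α⁻¹ + 3) * r) ∩ Ω, ENNReal.ofReal ‖fderiv ℝ u y‖ ^ p with hJ
    have hoverlap := sum_setLIntegral_ball_le (by omega) m z hdpos hsep hU
      (f := fun y => ENNReal.ofReal ‖fderiv ℝ u y‖ ^ p)
      ((measurable_fderiv ℝ u).norm.ennreal_ofReal.pow_const p)
    have hholder := sum_holder_le (by linarith) hpn hA0.le hδ0.le (N := (12 : ℝ) ^ n)
      (by positivity) (fun i _ => (hdpos i).le) hsum (J := J) (hoverlap.trans_eq (by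
        rw [ENNReal.ofReal_pow (by norm_num), ENNReal.ofReal_ofNat]))
    calc ENNReal.ofReal |u (γ 0) - u (γ L)|
        ≤ ENNReal.ofReal (∑ i ∈ Finset.range m, |u (z i) - u (z (i + 1))|) := by
          rw [← hz0, ← hzm]
          exact ENNReal.ofReal_le_ofReal (dist_le_range_sum_dist (fun i => u (z i)) m)
      _ = ∑ i ∈ Finset.range m, ENNReal.ofReal |u (z i) - u (z (i + 1))| :=
          ENNReal.ofReal_sum_of_nonneg fun _ _ => abs_nonneg _
      _ ≤ ∑ i ∈ Finset.range m, ENNReal.ofReal M *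
            (ENNReal.ofReal (infDist (z i) (frontier Ω) ^ (1 - (n : ℝ) / p)) *
              (∫⁻ y in ball (z i) (infDist (z i) (frontier Ω) / 2),
                ENNReal.ofReal ‖fderiv ℝ u y‖ ^ p) ^ (1 / p)) := by
          refine Finset.sum_le_sum fun i _ => ?_
          have hi := hdpos i
          refine (hmorrey Ω u hu (z i) (z (i + 1)) _ (half_pos hi) (hball _ (hzΩ i))
            (mem_closedBall'.2 (hstep i))).trans ?_
          rw [← mul_assoc, ← ENNReal.ofReal_mul hM]
          gcongr
          exact half_le_self hi.le
      _ ≤ ENNReal.ofReal M * (ENNReal.ofReal (B * δ ^ (1 - (n : ℝ) / p)) * J ^ (1 / p)) := by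
          rw [← Finset.mul_sum]
          gcongr
      _ ≤ ENNReal.ofReal ((1 + M + M * B) * δ ^ (1 - (n : ℝ) / p)) * J ^ (1 / p) := by
          rw [← mul_assoc, ← ENNReal.ofReal_mul hM, ← mul_assoc]
          gcongr
          linarith
end
end
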